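/- Let $(Y,\mu)$ be a probability space, $F:Y\to Y$ a measure-preserving map, and $\varphi:Y\to\{1,2,3,\dots\}$ a measurable function such that $\mu(\varphi>n)=\ell(n)n^{-1}$ for all $n\ge1$, where $\ell:(0,\infty)\to(0,\infty)$ is slowly varying (measurable, with $\lim_{x\to\infty}\ell(\lambda x)/\ell(x)=1$ for every $\lambda>0$) and $\sum_{j=1}^\infty \ell(j)/j=\infty$. Let $R:L^1(Y,\mu)\to L^1(Y,\mu)$ be the transfer operator of $F$, characterized by $\int_Y (Rv)\,w\,d\mu=\int_Y v\,(w\circ F)\,d\mu$ for all $v\in L^1(Y,\mu)$ and $w\in L^\infty(Y,\mu)$, and for $n\ge1$ put $R_nv=R(1_{\{\varphi=n\}}v)$. Let $\mathcal B\subset L^\infty(Y,\mu)$ be a linear subspace that contains the constant functions and is a complex Banach space under a norm $\|\cdot\|$ with $\|v\|_{L^\infty}\le\|v\|$ for all $v\in\mathcal B$. Assume: (H1) each $R_n$ maps $\mathcal B$ boundedly into $\mathcal B$, and there is a constant $C>0$ with $\|R_n\|_{\mathcal B\to\mathcal B}\le C\,\mu(\varphi=n)$ for all $n\ge1$; consequently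 $R(z)=\sum_{n\ge1}z^nR_n$ is a bounded operator on $\mathcal B$ for every complex $z$ with $|z|\le1$. (H2) (i) $1$ is an isolated point of the spectrum of $R(1)$ on $\mathcal B$ and is a simple eigenvalue, that is, of algebraic multiplicity one: for some $r>0$ such that $1$ is the only point of the spectrum in $\{|z-1|\le r\}$, the spectral projection $\frac1{2\pi i}\oint_{|z-1|=r}(z-R(1))^{-1}\,dz$ has rank one; (ii) for every complex $z\ne1$ with $|z|\le1$, $1$ does not belong to the spectrum of $R(z)$ on $\mathcal B$. Define $T_n:\mathcal B\to\mathcal B$ by $T_0=I$ and $T_n=\sum_{j=1}^nT_{n-j}R_j$ for $n\ge1$, let $\tilde\ell(n)=\sum_{j=1}^n\ell(j)/j$, and let $Pv=\bigl(\int_Yv\,d\mu\bigr)\cdot 1$ for $v\in\mathcal B$. Then $\lim_{n\to\infty}\tilde\ell(n)\,T_n=P$ in the operator norm on $\mathcal B$. -/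

import Mathlib

open MeasureTheory Filter Topology
open scoped ENNReal

/-- `l : (0,∞) → (0,∞)` is slowly varying: it is positive and measurable on `(0,∞)`, and
`l (c x) / l x → 1` as `x → ∞` for every `c > 0`. The values of `l` outside `(0,∞)` are
irrelevant. -/
def SlowlyVarying (l : ℝ → ℝ) : Prop :=
  (∀ x : ℝ, 0 < x → 0 < l x) ∧
  Measurable (fun x : Set.Ioi (0 : ℝ) => l x) ∧
  ∀ c : ℝ, 0 < c → Tendsto (fun x => l (c * x) / l x) atTop (𝓝 1)

section Transfer

variable {Y : Type*} [mY : MeasurableSpace Y] {μ : Measure Y} [IsProbabilityMeasure μ] {F : Y → Y}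

/-- Existence of the image of `v ∈ L¹` under the transfer operator of `F`. -/
theorem exists_transfer (hF : MeasurePreserving F μ μ) (v : Lp ℂ 1 μ) :
    ∃ u : Lp ℂ 1 μ, ∀ w : Y → ℂ, MemLp w ∞ μ →
      ∫ y, u y * w y ∂μ = ∫ y, v y * w (F y) ∂μ := by
  have hm : mY.comap F ≤ mY := hF.measurable.comap_le
  have hv : Integrable v μ := L1.integrable_coeFn v
  obtain ⟨g, hg, hgF⟩ :=
    (stronglyMeasurable_condExp (f := v) (m := mY.comap F) (μ := μ)).exists_eq_measurable_comp
  have hgi : Integrable g μ := by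
    rw [← hF.integrable_comp hg.aestronglyMeasurable, ← hgF]
    exact integrable_condExp
  refine ⟨hgi.toL1 g, fun w hw => ?_⟩
  have hwF : MemLp (w ∘ F) ∞ μ := hw.comp_measurePreserving hF
  have hwm : AEStronglyMeasurable[mY.comap F] (w ∘ F) μ := by
    refine ⟨hw.1.mk w ∘ F, ?_, ?_⟩
    · exact hw.1.stronglyMeasurable_mk.comp_measurable (comap_measurable F)
    · exact hF.quasiMeasurePreserving.ae_eq_comp hw.1.ae_eq_mk
  have hint : Integrable (fun y => v y * (w ∘ F) y) μ := hv.mul_of_top_left hwF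
  have hpull := condExp_bilin_of_aestronglyMeasurable_right (ContinuousLinearMap.mul ℝ ℂ)
    hwm hint hv
  calc ∫ y, (hgi.toL1 g) y * w y ∂μ = ∫ y, g y * w y ∂μ := by
        refine integral_congr_ae ?_
        filter_upwards [hgi.coeFn_toL1] with y hy
        rw [hy]
    _ = ∫ y, g (F y) * w (F y) ∂μ := by
        have h1 : AEStronglyMeasurable (fun y => g y * w y) (Measure.map F μ) := by
          rw [hF.map_eq]
          exact hg.aestronglyMeasurable.mul hw.1
        have h2 := integral_map hF.measurable.aemeasurable h1
        rwa [hF.map_eq] at h2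
    _ = ∫ y, (μ[fun y => v y * (w ∘ F) y | mY.comap F]) y ∂μ := by
        refine integral_congr_ae ?_
        filter_upwards [hpull] with y hy
        have h3 : (μ[v | mY.comap F]) y = g (F y) := congrFun hgF y
        simp only [ContinuousLinearMap.mul_apply'] at hy
        rw [hy, h3]
        rfl
    _ = ∫ y, v y * w (F y) ∂μ := integral_condExp hm

/-- An element of `L¹` is determined by its integrals against `L^∞`. -/
theorem l1_ext_of_integral_mul (u u' : Lp ℂ 1 μ)
    (h : ∀ w : Y → ℂ, MemLp w ∞ μ → ∫ y, u y * w y ∂μ = ∫ y, u' y * w y ∂μ) : u = u' := by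
  refine Lp.ext ((L1.integrable_coeFn u).ae_eq_of_forall_setIntegral_eq _ _
    (L1.integrable_coeFn u') fun s hs _ => ?_)
  have h1 := h (s.indicator fun _ => (1 : ℂ)) ((memLp_const (1 : ℂ)).indicator hs)
  have h2 : ∀ f : Y → ℂ,
      (fun y => f y * s.indicator (fun _ => (1 : ℂ)) y) = s.indicator f := by
    intro f
    ext y
    by_cases hy : y ∈ s <;> simp [hy]
  rwa [h2, h2, integral_indicator hs, integral_indicator hs] at h1

/-- The transfer operator `R : L¹(μ) → L¹(μ)` of a measure-preserving map `F`, that is, the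
unique operator with `∫ (R v) w dμ = ∫ v (w ∘ F) dμ` for all `v ∈ L¹` and `w ∈ L^∞`. -/
noncomputable def transferOperator (hF : MeasurePreserving F μ μ) :
    Lp ℂ 1 μ →ₗ[ℂ] Lp ℂ 1 μ where
  toFun v := (exists_transfer hF v).choose
  map_add' v v' := by
    refine l1_ext_of_integral_mul _ _ fun w hw => ?_
    have hwF : MemLp (w ∘ F) ∞ μ := hw.comp_measurePreserving hF
    rw [(exists_transfer hF (v + v')).choose_spec w hw]
    have e1 : ∀ a b : Lp ℂ 1 μ, ∀ g : Y → ℂ, MemLp g ∞ μ →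
        ∫ y, (a + b) y * g y ∂μ = ∫ y, a y * g y ∂μ + ∫ y, b y * g y ∂μ := by
      intro a b g hg
      have ha : Integrable (fun y => a y * g y) μ := (L1.integrable_coeFn a).mul_of_top_left hg
      have hb : Integrable (fun y => b y * g y) μ := (L1.integrable_coeFn b).mul_of_top_left hg
      rw [← integral_add ha hb]
      refine integral_congr_ae ?_
      filter_upwards [Lp.coeFn_add a b] with y hy
      rw [hy, Pi.add_apply, add_mul]
    have e2 := e1 v v' (w ∘ F) hwF
    simp only [Function.comp_apply] at e2
    rw [e2, e1 _ _ w hw, (exists_transfer hF v).choose_spec w hw,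
      (exists_transfer hF v').choose_spec w hw]
  map_smul' c v := by
    refine l1_ext_of_integral_mul _ _ fun w hw => ?_
    rw [(exists_transfer hF (c • v)).choose_spec w hw]
    have e1 : ∀ a : Lp ℂ 1 μ, ∀ g : Y → ℂ,
        ∫ y, (c • a) y * g y ∂μ = c * ∫ y, a y * g y ∂μ := by
      intro a g
      rw [← integral_const_mul]
      refine integral_congr_ae ?_
      filter_upwards [Lp.coeFn_smul c a] with y hy
      rw [hy, Pi.smul_apply, smul_eq_mul, mul_assoc]
    have e2 := e1 v (w ∘ F)
    simp only [Function.comp_apply] at e2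
    rw [e2, RingHom.id_apply, e1 _ w, (exists_transfer hF v).choose_spec w hw]

/-- The defining relation of the transfer operator. -/
theorem transferOperator_spec (hF : MeasurePreserving F μ μ) (v : Lp ℂ 1 μ) (w : Y → ℂ)
    (hw : MemLp w ∞ μ) :
    ∫ y, transferOperator hF v y * w y ∂μ = ∫ y, v y * w (F y) ∂μ :=
  (exists_transfer hF v).choose_spec w hw

/-- The inclusion of `L^∞(μ)` into `L¹(μ)`. -/
noncomputable def linftyToL1 (v : Lp ℂ ∞ μ) : Lp ℂ 1 μ :=
  ((Lp.memLp v).mono_exponent le_top).toLp v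

/-- The operator `R_n v = R (1_{φ = n} v)` on `L¹(μ)`. -/
noncomputable def returnOperator (hF : MeasurePreserving F μ μ) {φ : Y → ℕ}
    (hφ : Measurable φ) (n : ℕ) (v : Lp ℂ 1 μ) : Lp ℂ 1 μ :=
  transferOperator hF
    (((Lp.memLp v).indicator (hφ (measurableSet_singleton n))).toLp
      ((φ ⁻¹' {n}).indicator v))

/-- Integration as a continuous linear functional on `L^∞(μ)`. -/
noncomputable def integralLinfty (μ : Measure Y) [IsProbabilityMeasure μ] :
    Lp ℂ ∞ μ →L[ℂ] ℂ :=
  LinearMap.mkContinuous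
    { toFun := fun v => ∫ y, v y ∂μ
      map_add' := fun v v' => by
        rw [← integral_add ((Lp.memLp v).integrable le_top) ((Lp.memLp v').integrable le_top)]
        exact integral_congr_ae (Lp.coeFn_add v v')
      map_smul' := fun c v => by
        rw [RingHom.id_apply, smul_eq_mul, ← integral_const_mul]
        exact integral_congr_ae (Lp.coeFn_smul c v) }
    1 fun v => by
      have h : ∀ᵐ y ∂μ, ‖v y‖ ≤ ‖v‖ := by
        have h1 := ae_le_eLpNormEssSup (f := v) (μ := μ)
        filter_upwards [h1] with y hy
        rw [Lp.norm_def, eLpNorm_exponent_top, ← toReal_enorm]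
        refine ENNReal.toReal_mono ?_ hy
        rw [← eLpNorm_exponent_top]
        exact Lp.eLpNorm_ne_top v
      simpa using norm_integral_le_of_norm_le_const h

end Transfer

section Operators

variable {B : Type*} [NormedAddCommGroup B] [NormedSpace ℂ B]

/-- The power series `R(z) = ∑_{n ≥ 1} zⁿ R_n`, summed in the operator norm. -/
noncomputable def returnSeries (Rn : ℕ → B →L[ℂ] B) (z : ℂ) : B →L[ℂ] B :=
  ∑' n : ℕ, z ^ (n + 1) • Rn (n + 1)

/-- The renewal operators: `T_0 = I` and `T_n = ∑_{j=1}^n T_{n-j} R_j` for `n ≥ 1` (written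
here with `n + 1` in place of `n` and `j + 1` in place of `j`). -/
noncomputable def renewalOperator (Rn : ℕ → B →L[ℂ] B) : ℕ → B →L[ℂ] B
  | 0 => ContinuousLinearMap.id ℂ B
  | n + 1 => ∑ j : Fin (n + 1), (renewalOperator Rn (n - j)).comp (Rn (j + 1))
termination_by n => n
decreasing_by omega

/-- The Riesz integral `(2πi)⁻¹ ∮_{|z - c| = r} (z - A)⁻¹ dz`. When `c` is the only point of
the spectrum of `A` in the closed disk of radius `r` about `c`, this is the spectral projection
of `A` at `c`. -/
noncomputable def rieszProjection (A : B →L[ℂ] B) (c : ℂ) (r : ℝ) : B →L[ℂ] B :=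
  (2 * Real.pi * Complex.I : ℂ)⁻¹ • ∮ z in C(c, r), resolvent A z

/-- `c` is an isolated point of the spectrum of `A` and a simple eigenvalue, i.e. one of
algebraic multiplicity one: the spectral projection of `A` at `c` has rank one. -/
def IsSimpleIsolatedEigenvalue (A : B →L[ℂ] B) (c : ℂ) : Prop :=
  ∃ r : ℝ, 0 < r ∧ spectrum ℂ A ∩ Metric.closedBall c r = {c} ∧
    Module.finrank ℂ (rieszProjection A c r).range = 1

end Operators

/-- The truncated mean `∑_{j < n} p j` of a tail sequence `p`. -/
def truncMean (p : ℕ → ℝ) (n : ℕ) : ℝ := ∑ j ∈ Finset.range n, p j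

/-- Tail sequences of integer-valued return times with infinite, relatively stable mean. -/
structure RelativelyStableTail (p : ℕ → ℝ) : Prop where
  antitone : Antitone p
  nonneg : ∀ n, 0 ≤ p n
  zero : p 0 = 1
  tendsto_truncMean : Tendsto (truncMean p) atTop atTop
  tendsto_ratio : Tendsto (fun n : ℕ => n * p n / truncMean p n) atTop (𝓝 0)

namespace RelativelyStableTail

theorem truncMean_succ (p : ℕ → ℝ) (n : ℕ) : truncMean p (n + 1) = truncMean p n + p n :=
  Finset.sum_range_succ _ _

variable {p : ℕ → ℝ} (hp : RelativelyStableTail p)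
include hp

theorem le_one (n : ℕ) : p n ≤ 1 := hp.zero ▸ hp.antitone (Nat.zero_le n)

theorem truncMean_mono : Monotone (truncMean p) :=
  monotone_nat_of_le_succ fun n => by rw [truncMean_succ]; linarith [hp.nonneg n]

theorem one_le_truncMean {n : ℕ} (hn : 1 ≤ n) : 1 ≤ truncMean p n := by
  have := hp.truncMean_mono hn
  simpa [truncMean, hp.zero] using this

theorem truncMean_pos {n : ℕ} (hn : 1 ≤ n) : 0 < truncMean p n :=
  lt_of_lt_of_le one_pos (hp.one_le_truncMean hn)

theorem diff_nonneg (n : ℕ) : 0 ≤ p n - p (n + 1) :=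
  sub_nonneg.2 (hp.antitone n.le_succ)

theorem summable_diff : Summable fun n => p n - p (n + 1) := by
  refine summable_of_sum_range_le (c := 1) hp.diff_nonneg fun n => ?_
  rw [Finset.sum_range_sub', hp.zero]
  linarith [hp.nonneg n]

/-- Growth bound of Potter type for the truncated mean. -/
theorem exists_truncMean_pow_le :
    ∃ C : ℝ, 0 < C ∧ ∀ n N : ℕ, 1 ≤ n → 1 ≤ N →
      truncMean p n ^ 4 ≤ C * (1 + n / N) * truncMean p N ^ 4 := by
  have h15 : ∀ᶠ n : ℕ in atTop, n * p n / truncMean p n < 1 / 15 :=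
    hp.tendsto_ratio.eventually_lt_const (by norm_num)
  obtain ⟨n₀, hn₀⟩ := eventually_atTop.1 h15
  set k := max n₀ 1 with hk
  have hk1 : 1 ≤ k := le_max_right _ _
  have step : ∀ n, k ≤ n →
      truncMean p (n + 1) ^ 4 * n ≤ truncMean p n ^ 4 * (n + 1 : ℕ) := by
    intro n hn
    have hn1 : 1 ≤ n := hk1.trans hn
    have hM := hp.truncMean_pos hn1
    have h := hn₀ n ((le_max_left _ _).trans hn)
    rw [div_lt_iff₀ hM] at h
    have hn' : (0 : ℝ) < n := by exact_mod_cast hn1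
    have hn1' : (1 : ℝ) ≤ n := by exact_mod_cast hn1
    set x : ℝ := 1 / n with hx
    have hx0 : 0 < x := by positivity
    have hx1 : x ≤ 1 := by rw [hx, div_le_one hn']; exact hn1'
    have hnx : (n : ℝ) * x = 1 := by rw [hx]; field_simp
    have hle : truncMean p (n + 1) ≤ truncMean p n * (1 + x / 15) := by
      rw [truncMean_succ]
      have : p n ≤ truncMean p n * (x / 15) := by
        have h2 : p n = (n * p n) * x := by rw [mul_right_comm, hnx, one_mul]
        rw [h2]
        nlinarith
      linarith
    have hpoly : (1 + x / 15) ^ 4 ≤ 1 + x := by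
      have h2 : x ^ 2 ≤ x := by nlinarith
      have h3 : x ^ 3 ≤ x := by nlinarith [sq_nonneg x]
      have h4 : x ^ 4 ≤ x := by nlinarith [sq_nonneg x]
      nlinarith
    have hM1 : 0 ≤ truncMean p (n + 1) := (hp.truncMean_pos (by omega)).le
    calc truncMean p (n + 1) ^ 4 * n ≤ (truncMean p n * (1 + x / 15)) ^ 4 * n := by gcongr
      _ = truncMean p n ^ 4 * ((1 + x / 15) ^ 4 * n) := by ring
      _ ≤ truncMean p n ^ 4 * ((1 + x) * n) := by gcongr
      _ = truncMean p n ^ 4 * (n + 1 : ℕ) := by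
        push_cast; rw [add_mul, mul_comm x, hnx]; ring
  have chain : ∀ N n, k ≤ N → N ≤ n → truncMean p n ^ 4 * N ≤ truncMean p N ^ 4 * n := by
    intro N n hN hn
    induction n, hn using Nat.le_induction with
    | base => exact le_rfl
    | succ n hn ih =>
      have h1 := step n (hN.trans hn)
      have hn' : (0 : ℝ) < n := by exact_mod_cast (by omega : 0 < n)
      refine le_of_mul_le_mul_right ?_ hn'
      calc truncMean p (n + 1) ^ 4 * N * n = truncMean p (n + 1) ^ 4 * n * N := by ring
        _ ≤ truncMean p n ^ 4 * (n + 1 : ℕ) * N := by gcongr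
        _ = truncMean p n ^ 4 * N * (n + 1 : ℕ) := by ring
        _ ≤ truncMean p N ^ 4 * n * (n + 1 : ℕ) := by gcongr
        _ = _ := by ring
  have hMk := hp.one_le_truncMean hk1
  have hMk4 : 1 ≤ truncMean p k ^ 4 := one_le_pow₀ hMk
  have hk1' : (1 : ℝ) ≤ k := by exact_mod_cast hk1
  refine ⟨k * truncMean p k ^ 4, by positivity, fun n N hn hN => ?_⟩
  have hMN := hp.one_le_truncMean hN
  have hMN4 : 1 ≤ truncMean p N ^ 4 := one_le_pow₀ hMN
  have hMn := hp.truncMean_pos hn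
  have hN' : (0 : ℝ) < N := by exact_mod_cast hN
  have hn' : (0 : ℝ) < n := by exact_mod_cast hn
  have hC : 1 ≤ k * truncMean p k ^ 4 := by nlinarith
  rcases le_total n N with h | h
  · calc truncMean p n ^ 4 ≤ truncMean p N ^ 4 := by
          gcongr; exact hp.truncMean_mono h
      _ = 1 * 1 * truncMean p N ^ 4 := by ring
      _ ≤ _ := by
        gcongr
        have : 0 ≤ (n : ℝ) / N := by positivity
        linarith
  rcases le_total k N with h2 | h2
  · have h3 := chain N n h2 h
    calc truncMean p n ^ 4 ≤ truncMean p N ^ 4 * n / N := by rwa [le_div_iff₀ hN']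
      _ = 1 * (n / N) * truncMean p N ^ 4 := by ring
      _ ≤ _ := by gcongr; linarith
  · have hNk : (N : ℝ) ≤ k := by exact_mod_cast h2
    rcases le_total k n with h3 | h3
    · have h4 := chain k n le_rfl h3
      have h5 : truncMean p n ^ 4 ≤ truncMean p k ^ 4 * n := by
        have : truncMean p n ^ 4 * 1 ≤ truncMean p n ^ 4 * k := by gcongr
        linarith
      calc truncMean p n ^ 4 ≤ truncMean p k ^ 4 * n * 1 := by linarith
        _ ≤ truncMean p k ^ 4 * n * ((k / N) * truncMean p N ^ 4) := by
          gcongr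
          have : 1 ≤ (k : ℝ) / N := by rwa [one_le_div hN']
          nlinarith
        _ = k * truncMean p k ^ 4 * (n / N) * truncMean p N ^ 4 := by ring
        _ ≤ _ := by gcongr; linarith
    · calc truncMean p n ^ 4 ≤ truncMean p k ^ 4 := by
            gcongr; exact hp.truncMean_mono h3
        _ = 1 * truncMean p k ^ 4 * 1 * 1 := by ring
        _ ≤ _ := by
          gcongr
          have : 0 ≤ (n : ℝ) / N := by positivity
          linarith

theorem tendsto_sum_mul_div :
    Tendsto (fun N : ℕ => (∑ k ∈ Finset.range N, k * p k) / (N * truncMean p N)) atTop (𝓝 0) := by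
  have hlo : (fun k : ℕ => (k : ℝ) * p k) =o[atTop] truncMean p := by
    refine (Asymptotics.isLittleO_iff_tendsto' ?_).2 hp.tendsto_ratio
    filter_upwards [eventually_ge_atTop 1] with n hn h
    exact absurd h (hp.truncMean_pos hn).ne'
  have hM0 : ∀ n, 0 ≤ truncMean p n := fun n => Finset.sum_nonneg fun j _ => hp.nonneg j
  have hdiv : Tendsto (fun n => ∑ i ∈ Finset.range n, truncMean p i) atTop atTop := by
    refine tendsto_atTop_mono' atTop ?_ (hp.tendsto_truncMean.comp (tendsto_sub_atTop_nat 1))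
    filter_upwards [eventually_ge_atTop 1] with n hn
    exact Finset.single_le_sum (f := truncMean p) (fun i _ => hM0 i)
      (Finset.mem_range.2 (by omega : n - 1 < n))
  have hsum := hlo.sum_range hM0 hdiv
  have hO : (fun n => ∑ i ∈ Finset.range n, truncMean p i) =O[atTop]
      fun N : ℕ => (N : ℝ) * truncMean p N := by
    refine Asymptotics.IsBigO.of_bound 1 (Eventually.of_forall fun N => ?_)
    rw [Real.norm_of_nonneg (Finset.sum_nonneg fun i _ => hM0 i),
      Real.norm_of_nonneg (mul_nonneg N.cast_nonneg (hM0 N)), one_mul]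
    calc ∑ i ∈ Finset.range N, truncMean p i ≤ ∑ i ∈ Finset.range N, truncMean p N :=
          Finset.sum_le_sum fun i hi => hp.truncMean_mono (Finset.mem_range.1 hi).le
      _ = N * truncMean p N := by simp
  exact (hsum.trans_isBigO hO).tendsto_div_nhds_zero

theorem sum_diff_mul_min_le (N J : ℕ) :
    ∑ j ∈ Finset.range J, (p j - p (j + 1)) * (min (j + 1) N : ℕ) ≤ truncMean p N := by
  have h : ∀ J, ∑ j ∈ Finset.range J, (p j - p (j + 1)) * (min (j + 1) N : ℕ) =
      truncMean p (min J N) - p J * (min J N : ℕ) := by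
    intro J
    induction J with
    | zero => simp [truncMean]
    | succ J ih =>
      rw [Finset.sum_range_succ, ih]
      rcases lt_or_ge J N with h | h
      · rw [min_eq_left h.le, min_eq_left (Nat.succ_le_of_lt h), truncMean_succ]
        push_cast; ring
      · rw [min_eq_right h, min_eq_right (h.trans J.le_succ)]
        ring
  rw [h]
  have h1 := hp.truncMean_mono (min_le_right J N)
  have h2 : 0 ≤ p J * (min J N : ℕ) := mul_nonneg (hp.nonneg J) (Nat.cast_nonneg _)
  linarith

theorem summable_mul_pow {z : ℂ} (hz : ‖z‖ < 1) : Summable fun k => (p k : ℂ) * z ^ k := by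
  refine Summable.of_norm_bounded (summable_geometric_of_lt_one (norm_nonneg z) hz) fun k => ?_
  rw [norm_mul, norm_pow, Complex.norm_of_nonneg (hp.nonneg k)]
  exact mul_le_of_le_one_left (by positivity) (hp.le_one k)

theorem one_sub_tsum_diff {z : ℂ} (hz : ‖z‖ < 1) :
    1 - ∑' k, ((p k - p (k + 1) : ℝ) : ℂ) * z ^ (k + 1) =
      (1 - z) * ∑' k, (p k : ℂ) * z ^ k := by
  have hs := hp.summable_mul_pow hz
  have h1 := hs.tsum_eq_zero_add
  have hs1 : Summable fun k => (p (k + 1) : ℂ) * z ^ (k + 1) :=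
    (summable_nat_add_iff (f := fun k => (p k : ℂ) * z ^ k) 1).2 hs
  have hs2 := hs.mul_left z
  have h2 : ∑' k, ((p k - p (k + 1) : ℝ) : ℂ) * z ^ (k + 1) =
      z * ∑' k, (p k : ℂ) * z ^ k - ∑' k, (p (k + 1) : ℂ) * z ^ (k + 1) := by
    rw [← tsum_mul_left, ← hs2.tsum_sub hs1]
    refine tsum_congr fun k => ?_
    push_cast; ring
  rw [h2]
  simp only [hp.zero, pow_zero, Complex.ofReal_one, mul_one] at h1
  linear_combination -h1

theorem norm_tsum_sub_truncMean_le {z : ℂ} (hz : ‖z‖ < 1) (N : ℕ) :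
    ‖∑' k, (p k : ℂ) * z ^ k - truncMean p N‖ ≤
      ‖1 - z‖ * ∑ k ∈ Finset.range N, k * p k + 2 * p N / ‖1 - z‖ := by
  have hs := hp.summable_mul_pow hz
  have hz1 : z ≠ 1 := by rintro rfl; simp at hz
  have hq : 0 < ‖1 - z‖ := norm_pos_iff.2 (sub_ne_zero.2 hz1.symm)
  have hsplit := hs.sum_add_tsum_nat_add N
  have hpow : ∀ k : ℕ, ‖z ^ k - 1‖ ≤ k * ‖1 - z‖ := by
    intro k
    rw [← geom_sum_mul, norm_mul, norm_sub_rev z 1]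
    gcongr
    refine (norm_sum_le _ _).trans ?_
    calc ∑ i ∈ Finset.range k, ‖z ^ i‖ ≤ ∑ i ∈ Finset.range k, (1 : ℝ) :=
          Finset.sum_le_sum fun i _ => by
            rw [norm_pow]; exact pow_le_one₀ (norm_nonneg z) hz.le
      _ = k := by simp
  have hhead : ‖∑ k ∈ Finset.range N, (p k : ℂ) * z ^ k - truncMean p N‖ ≤
      ‖1 - z‖ * ∑ k ∈ Finset.range N, k * p k := by
    rw [truncMean, Complex.ofReal_sum, ← Finset.sum_sub_distrib, Finset.mul_sum]
    refine (norm_sum_le _ _).trans (Finset.sum_le_sum fun k _ => ?_)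
    have : (p k : ℂ) * z ^ k - p k = p k * (z ^ k - 1) := by ring
    rw [this, norm_mul, Complex.norm_of_nonneg (hp.nonneg k)]
    calc p k * ‖z ^ k - 1‖ ≤ p k * (k * ‖1 - z‖) :=
          mul_le_mul_of_nonneg_left (hpow k) (hp.nonneg k)
      _ = _ := by ring
  have htail : ‖∑' k, (p (k + N) : ℂ) * z ^ (k + N)‖ ≤ 2 * p N / ‖1 - z‖ := by
    have hsN : Summable fun k => (p (k + N) : ℂ) * z ^ (k + N) :=
      (summable_nat_add_iff (f := fun k => (p k : ℂ) * z ^ k) N).2 hs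
    have h1 := hsN.tsum_eq_zero_add
    have hsN1 : Summable fun k => (p (k + 1 + N) : ℂ) * z ^ (k + 1 + N) :=
      (summable_nat_add_iff (f := fun k => (p (k + N) : ℂ) * z ^ (k + N)) 1).2 hsN
    have hd : Summable fun k => p (k + N) - p (k + 1 + N) := by
      have := (summable_nat_add_iff (f := fun k => p k - p (k + 1)) N).2 hp.summable_diff
      refine this.congr fun k => ?_
      rw [add_right_comm]
    have hdle : ∑' k, (p (k + N) - p (k + 1 + N)) ≤ p N := by
      refine hd.tsum_le_of_sum_range_le fun n => ?_
      rw [Finset.sum_range_sub' (fun k => p (k + N))]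
      simpa using hp.nonneg (n + N)
    have hdn : ∀ k, 0 ≤ p (k + N) - p (k + 1 + N) := fun k =>
      sub_nonneg.2 (hp.antitone (by omega))
    have h2 : (1 - z) * ∑' k, (p (k + N) : ℂ) * z ^ (k + N) =
        p N * z ^ N - ∑' k, ((p (k + N) - p (k + 1 + N) : ℝ) : ℂ) * z ^ (k + 1 + N) := by
      have h3 : ∑' k, ((p (k + N) - p (k + 1 + N) : ℝ) : ℂ) * z ^ (k + 1 + N) =
          z * ∑' k, (p (k + N) : ℂ) * z ^ (k + N) -
            ∑' k, (p (k + 1 + N) : ℂ) * z ^ (k + 1 + N) := by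
        rw [← tsum_mul_left, ← (hsN.mul_left z).tsum_sub hsN1]
        refine tsum_congr fun k => ?_
        push_cast; ring
      rw [h3]
      simp only [zero_add] at h1
      linear_combination h1
    rw [le_div_iff₀ hq, mul_comm, ← norm_mul, h2]
    refine (norm_sub_le _ _).trans ?_
    have hzk : ∀ k : ℕ, ‖z ^ k‖ ≤ 1 := fun k => by
      rw [norm_pow]; exact pow_le_one₀ (norm_nonneg z) hz.le
    have ha : ‖(p N : ℂ) * z ^ N‖ ≤ p N := by
      rw [norm_mul, Complex.norm_of_nonneg (hp.nonneg N)]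
      exact mul_le_of_le_one_right (hp.nonneg N) (hzk N)
    have hb : ‖∑' k, ((p (k + N) - p (k + 1 + N) : ℝ) : ℂ) * z ^ (k + 1 + N)‖ ≤ p N := by
      refine (tsum_of_norm_bounded hd.hasSum fun k => ?_).trans hdle
      rw [norm_mul, Complex.norm_of_nonneg (hdn k)]
      exact mul_le_of_le_one_right (hdn k) (hzk _)
    linarith
  calc ‖∑' k, (p k : ℂ) * z ^ k - truncMean p N‖
      = ‖(∑ k ∈ Finset.range N, (p k : ℂ) * z ^ k - truncMean p N) +
          ∑' k, (p (k + N) : ℂ) * z ^ (k + N)‖ := by rw [← hsplit]; congr 1; ring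
    _ ≤ _ := (norm_add_le _ _).trans (add_le_add hhead htail)

end RelativelyStableTail

theorem SlowlyVarying.tendsto_nat_mul_div_truncMean {l : ℝ → ℝ} (hl : SlowlyVarying l)
    {p : ℕ → ℝ} (hanti : Antitone p) (hnonneg : ∀ n, 0 ≤ p n)
    (htail : ∀ n : ℕ, 1 ≤ n → p n = l n / n) :
    Tendsto (fun n : ℕ => n * p n / truncMean p n) atTop (𝓝 0) := by
  have hM : ∀ k n : ℕ, ∑ i ∈ Finset.range k, n * p ((i + 1) * n) ≤ truncMean p (k * n) := by
    intro k n
    induction k with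
    | zero => simp [truncMean]
    | succ k ih =>
      rw [Finset.sum_range_succ, add_mul, one_mul, truncMean, Finset.sum_range_add]
      refine add_le_add ih ?_
      calc n * p (k * n + n) = ∑ x ∈ Finset.range n, p (k * n + n) := by simp
        _ ≤ _ := Finset.sum_le_sum fun x hx => hanti (by
          have := Finset.mem_range.1 hx
          omega)
  have key : ∀ k : ℕ, 1 ≤ k → ∀ᶠ N : ℕ in atTop,
      N * p N / truncMean p N ≤ 8 / ∑ i ∈ Finset.range k, 1 / ((i : ℝ) + 1) := by
    intro k hk
    have hlow : ∀ᶠ n : ℕ in atTop, ∀ i ∈ Finset.range k, l n / 2 ≤ l (((i + 1 : ℕ) : ℝ) * n) := by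
      rw [eventually_all_finset]
      intro i _
      have h := (hl.2.2 ((i + 1 : ℕ) : ℝ) (by positivity)).comp tendsto_natCast_atTop_atTop
      filter_upwards [h.eventually_const_lt (by norm_num : (1 / 2 : ℝ) < 1),
        eventually_ge_atTop 1] with n hn hn1
      have hp := hl.1 n (by exact_mod_cast hn1)
      simp only [Function.comp_apply] at hn
      rw [lt_div_iff₀ hp] at hn
      linarith
    have hup : ∀ᶠ n : ℕ in atTop, l ((k : ℝ) * n) ≤ 2 * l n := by
      have h := (hl.2.2 (k : ℝ) (by positivity)).comp tendsto_natCast_atTop_atTop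
      filter_upwards [h.eventually_lt_const (by norm_num : (1 : ℝ) < 2),
        eventually_ge_atTop 1] with n hn hn1
      have hp := hl.1 n (by exact_mod_cast hn1)
      simp only [Function.comp_apply] at hn
      rw [div_lt_iff₀ hp] at hn
      exact hn.le
    have hdiv : Tendsto (fun N : ℕ => N / k) atTop atTop :=
      Nat.tendsto_div_const_atTop (by omega)
    filter_upwards [hdiv.eventually hlow, hdiv.eventually hup,
      hdiv.eventually (eventually_ge_atTop 1)] with N h1 h2 h3
    set n := N / k with hn
    have hkn : k * n ≤ N := Nat.mul_div_le N k
    have hNk : N < k * (n + 1) := Nat.lt_mul_div_succ N (by omega)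
    have hn0 : (1 : ℝ) ≤ n := by exact_mod_cast h3
    have hln := hl.1 n (by linarith)
    set H := ∑ i ∈ Finset.range k, 1 / ((i : ℝ) + 1) with hH
    have hHpos : 0 < H := Finset.sum_pos (fun i _ => by positivity) ⟨0, by simp; omega⟩
    have hMN : l n * H / 2 ≤ truncMean p N := by
      have hmono : truncMean p (k * n) ≤ truncMean p N :=
        Finset.sum_le_sum_of_subset_of_nonneg
          (Finset.range_subset_range.2 hkn) fun i _ _ => hnonneg i
      refine le_trans ?_ ((hM k n).trans hmono)
      rw [hH, Finset.mul_sum, Finset.sum_div]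
      refine Finset.sum_le_sum fun i hi => ?_
      rw [htail _ (by nlinarith)]
      have h4 := h1 i hi
      have h5 : (n : ℝ) * (l (((i + 1) * n : ℕ) : ℝ) / ((i + 1) * n : ℕ)) =
          l (((i + 1 : ℕ) : ℝ) * n) / ((i : ℝ) + 1) := by
        push_cast; field_simp
      rw [h5]
      calc l n * (1 / ((i : ℝ) + 1)) / 2 = l n / 2 / ((i : ℝ) + 1) := by ring
        _ ≤ _ := by gcongr
    have hNp : N * p N ≤ 4 * l n := by
      calc (N : ℝ) * p N ≤ (k * (n + 1) : ℕ) * p (k * n) :=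
            mul_le_mul (by exact_mod_cast hNk.le) (hanti hkn) (hnonneg _) (Nat.cast_nonneg _)
        _ ≤ (2 * (k * n) : ℝ) * p (k * n) := by
            refine mul_le_mul_of_nonneg_right ?_ (hnonneg _)
            push_cast
            have : (0 : ℝ) ≤ k := Nat.cast_nonneg k
            nlinarith
        _ = 2 * l (k * n) := by
            rw [htail _ (by nlinarith)]
            have : (k : ℝ) ≠ 0 := by positivity
            push_cast; field_simp
        _ ≤ _ := by linarith
    have hpos : 0 < l n * H / 2 := by positivity
    calc N * p N / truncMean p N ≤ 4 * l n / (l n * H / 2) := by gcongr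
      _ = 8 / H := by field_simp; norm_num
  rw [tendsto_order]
  refine ⟨fun a ha => Eventually.of_forall fun n => lt_of_lt_of_le ha ?_, fun a ha => ?_⟩
  · exact div_nonneg (mul_nonneg n.cast_nonneg (hnonneg n))
      (Finset.sum_nonneg fun j _ => hnonneg j)
  · have h8 : Tendsto (fun k : ℕ => 8 / ∑ i ∈ Finset.range k, 1 / ((i : ℝ) + 1)) atTop (𝓝 0) :=
      tendsto_const_nhds.div_atTop Real.tendsto_sum_range_one_div_nat_succ_atTop
    obtain ⟨k, hk, hk1⟩ := ((h8.eventually_lt_const ha).and (eventually_ge_atTop 1)).exists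
    filter_upwards [key k hk1] with N hN
    exact hN.trans_lt hk

theorem sum_Icc_one_eq_truncMean (p : ℕ → ℝ) (n : ℕ) :
    ∑ j ∈ Finset.Icc 1 n, p j = truncMean p n + p n - p 0 := by
  induction n with
  | zero => simp [truncMean]
  | succ n ih =>
    rw [Finset.sum_Icc_succ_top (by omega), ih, RelativelyStableTail.truncMean_succ]
    ring

theorem SlowlyVarying.relativelyStableTail {l : ℝ → ℝ} (hl : SlowlyVarying l)
    {p : ℕ → ℝ} (hanti : Antitone p) (hnonneg : ∀ n, 0 ≤ p n) (hzero : p 0 = 1)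
    (htail : ∀ n : ℕ, 1 ≤ n → p n = l n / n)
    (hdiv : Tendsto (fun n : ℕ => ∑ j ∈ Finset.Icc 1 n, l j / j) atTop atTop) :
    RelativelyStableTail p where
  antitone := hanti
  nonneg := hnonneg
  zero := hzero
  tendsto_truncMean := by
    refine tendsto_atTop_mono (fun n => ?_) hdiv
    have h : ∑ j ∈ Finset.Icc 1 n, l j / j = ∑ j ∈ Finset.Icc 1 n, p j :=
      Finset.sum_congr rfl fun j hj => (htail j (Finset.mem_Icc.1 hj).1).symm
    rw [h, sum_Icc_one_eq_truncMean]
    linarith [hanti (Nat.zero_le n)]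
  tendsto_ratio := hl.tendsto_nat_mul_div_truncMean hanti hnonneg htail

theorem RelativelyStableTail.tendsto_sum_Icc_div_truncMean {p : ℕ → ℝ}
    (hp : RelativelyStableTail p) :
    Tendsto (fun n : ℕ => (∑ j ∈ Finset.Icc 1 n, p j) / truncMean p n) atTop (𝓝 1) := by
  have hb : Tendsto (fun n : ℕ => (p n - 1) / truncMean p n) atTop (𝓝 0) := by
    refine squeeze_zero_norm' (a := fun n => 1 / truncMean p n) ?_
      (tendsto_const_nhds.div_atTop hp.tendsto_truncMean)
    filter_upwards [eventually_ge_atTop 1] with n hn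
    rw [norm_div, Real.norm_of_nonneg (hp.truncMean_pos hn).le]
    have hM := hp.truncMean_pos hn
    gcongr
    rw [Real.norm_eq_abs, abs_le]
    constructor <;> linarith [hp.nonneg n, hp.le_one n]
  have h1 : Tendsto (fun n : ℕ => 1 + (p n - 1) / truncMean p n) atTop (𝓝 1) := by
    simpa using hb.const_add 1
  refine h1.congr' ?_
  filter_upwards [eventually_ge_atTop 1] with n hn
  have hM := hp.truncMean_pos hn
  rw [sum_Icc_one_eq_truncMean, hp.zero]
  field_simp
  ring

theorem ContinuousLinearMap.circleIntegral_comp_comm {E E' : Type*} [NormedAddCommGroup E]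
    [NormedSpace ℂ E] [CompleteSpace E] [NormedAddCommGroup E'] [NormedSpace ℂ E']
    [CompleteSpace E'] (L : E →L[ℂ] E') {f : ℂ → E} {c : ℂ} {r : ℝ}
    (hf : CircleIntegrable f c r) : ∮ z in C(c, r), L (f z) = L (∮ z in C(c, r), f z) := by
  simp only [circleIntegral]
  rw [← L.intervalIntegral_comp_comm hf.out]
  simp only [map_smul]

section SpectralProjection


theorem continuousOn_resolvent {𝓐 : Type*} [NormedRing 𝓐] [NormedAlgebra ℂ 𝓐] [CompleteSpace 𝓐]
    (a : 𝓐) : ContinuousOn (resolvent a) (resolventSet ℂ a) := fun z hz => by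
  have h : ContinuousAt (Ring.inverse : 𝓐 → 𝓐) (algebraMap ℂ 𝓐 z - a) := by
    exact NormedRing.inverse_continuousAt (IsUnit.unit hz)
  have h2 : ContinuousAt (fun w : ℂ => algebraMap ℂ 𝓐 w - a) z :=
    ((continuous_algebraMap ℂ 𝓐).sub continuous_const).continuousAt
  exact (ContinuousAt.comp (f := fun w : ℂ => algebraMap ℂ 𝓐 w - a) h h2).continuousWithinAt

variable {B : Type*} [NormedAddCommGroup B] [NormedSpace ℂ B]
  {A : B →L[ℂ] B} {ψ : B →L[ℂ] ℂ} {e : B}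

theorem resolvent_apply_eigenvector (he : A e = e) {z : ℂ} (hz : z ∈ resolventSet ℂ A)
    (hz1 : z ≠ 1) : resolvent A z e = (z - 1)⁻¹ • e := by
  have h : resolvent A z * (algebraMap ℂ _ z - A) = 1 := Ring.inverse_mul_cancel _ hz
  have h1 := congrArg (fun L : B →L[ℂ] B => L e) h
  have h2 : (algebraMap ℂ (B →L[ℂ] B) z - A) e = (z - 1) • e := by
    simp [Algebra.algebraMap_eq_smul_one, he, sub_smul]
  simp only [mul_apply_eq_comp, h2, map_smul, one_apply_eq_self] at h1
  rw [eq_inv_smul_iff₀ (sub_ne_zero.2 hz1), h1]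

theorem eigenfunctional_resolvent (hψ : ψ.comp A = ψ) {z : ℂ} (hz : z ∈ resolventSet ℂ A)
    (hz1 : z ≠ 1) (v : B) : ψ (resolvent A z v) = (z - 1)⁻¹ * ψ v := by
  have h : (algebraMap ℂ _ z - A) * resolvent A z = 1 := Ring.mul_inverse_cancel _ hz
  have h1 := congrArg (fun L : B →L[ℂ] B => ψ (L v)) h
  have h2 : ∀ w, ψ ((algebraMap ℂ (B →L[ℂ] B) z - A) w) = (z - 1) * ψ w := by
    intro w
    have h3 : ψ (A w) = ψ w := congrArg (fun L : B →L[ℂ] ℂ => L w) hψ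
    simp [Algebra.algebraMap_eq_smul_one, h3, sub_mul]
  simp only [mul_apply_eq_comp, h2, one_apply_eq_self] at h1
  rw [← h1, inv_mul_cancel_left₀ (sub_ne_zero.2 hz1)]

/-- If `1` is a simple isolated eigenvalue of `A` with right and left eigenvectors `e` and `ψ`,
then `1 - A` becomes invertible once the spectral projection `v ↦ ψ v • e` is added to it. -/
theorem IsSimpleIsolatedEigenvalue.isUnit_one_sub_add [CompleteSpace B]
    (h : IsSimpleIsolatedEigenvalue A 1)
    (he : A e = e) (hψ : ψ.comp A = ψ) (hψe : ψ e = 1) :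
    IsUnit (1 - A + ψ.smulRight e) := by
  obtain ⟨r, hr, hspec, hrank⟩ := h
  have hres : ∀ z ∈ Metric.sphere (1 : ℂ) r, z ≠ 1 ∧ z ∈ resolventSet ℂ A := by
    intro z hz
    have hz1 : z ≠ 1 := by rintro rfl; simp at hz; exact hr.ne hz
    refine ⟨hz1, ?_⟩
    by_contra hcon
    have : z ∈ spectrum ℂ A ∩ Metric.closedBall 1 r := ⟨hcon, Metric.sphere_subset_closedBall hz⟩
    rw [hspec] at this
    exact hz1 this
  have hcont : ContinuousOn (resolvent A) (Metric.sphere (1 : ℂ) r) :=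
    (continuousOn_resolvent A).mono fun z hz => (hres z hz).2
  have hcinv : ContinuousOn (fun z : ℂ => (z - 1)⁻¹) (Metric.sphere (1 : ℂ) r) :=
    (continuousOn_id.sub continuousOn_const).inv₀ fun z hz => sub_ne_zero.2 (hres z hz).1
  have hint : CircleIntegrable (resolvent A) 1 r := hcont.circleIntegrable hr.le
  have hint2 : CircleIntegrable (fun z => (z - 1)⁻¹ • resolvent A z) 1 r :=
    (hcinv.smul hcont).circleIntegrable hr.le
  have h2pi : (2 * Real.pi * Complex.I : ℂ) ≠ 0 := Complex.two_pi_I_ne_zero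
  set κ : ℂ := (2 * Real.pi * Complex.I : ℂ) with hκ
  have hI1 : ∮ z in C(1, r), (z - 1)⁻¹ = κ := circleIntegral.integral_sub_center_inv 1 hr.ne'
  have hI2 : ∮ z in C(1, r), (z - 1)⁻¹ * (z - 1)⁻¹ = 0 := by
    have := circleIntegral.integral_sub_zpow_of_ne (n := -2) (by norm_num) 1 1 r
    rw [← this]
    refine circleIntegral.integral_congr hr.le fun z _ => ?_
    simp only [zpow_neg]
    rw [← mul_inv]; congr 1; norm_cast; ring
  set Q := rieszProjection A 1 r with hQ
  have hQdef : Q = κ⁻¹ • ∮ z in C(1, r), resolvent A z := rfl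
  -- the spectral projection is `ψ.smulRight e`
  have hQe : Q e = e := by
    have h1 := (ContinuousLinearMap.apply ℂ B e).circleIntegral_comp_comm hint
    simp only [ContinuousLinearMap.apply_apply] at h1
    rw [hQdef, _root_.smul_apply, ← h1,
      circleIntegral.integral_congr hr.le (g := fun z => (z - 1)⁻¹ • e)
        fun z hz => resolvent_apply_eigenvector he (hres z hz).2 (hres z hz).1,
      circleIntegral.integral_smul_const, hI1, inv_smul_smul₀ h2pi]
  have hψQ : ∀ v, ψ (Q v) = ψ v := by
    intro v
    have h1 := (ψ.comp (ContinuousLinearMap.apply ℂ B v)).circleIntegral_comp_comm hint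
    simp only [ContinuousLinearMap.comp_apply, ContinuousLinearMap.apply_apply] at h1
    rw [hQdef, _root_.smul_apply, map_smul, ← h1,
      circleIntegral.integral_congr hr.le (g := fun z => (z - 1)⁻¹ • ψ v)
        fun z hz => eigenfunctional_resolvent hψ (hres z hz).2 (hres z hz).1 v,
      circleIntegral.integral_smul_const, hI1, inv_smul_smul₀ h2pi]
  have he0 : e ≠ 0 := by rintro rfl; simp at hψe
  have hQP : Q = ψ.smulRight e := by
    ext v
    have he' : (⟨e, ⟨e, hQe⟩⟩ : Q.range) ≠ 0 := fun h => he0 (congrArg Subtype.val h)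
    obtain ⟨c, hc⟩ := (finrank_eq_one_iff_of_nonzero' _ he').1 hrank ⟨Q v, ⟨v, rfl⟩⟩
    have hc' : c • e = Q v := congrArg Subtype.val hc
    have : c = ψ v := by
      rw [← hψQ v, ← hc', map_smul, hψe, smul_eq_mul, mul_one]
    rw [← hc', this, ContinuousLinearMap.smulRight_apply]
  set P := ψ.smulRight e with hP
  set S := κ⁻¹ • ∮ z in C(1, r), (z - 1)⁻¹ • resolvent A z with hS
  have hbase : κ⁻¹ • ∮ z in C(1, r), ((z - 1)⁻¹ • (1 : B →L[ℂ] B) - resolvent A z) = 1 - P := by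
    rw [circleIntegral.integral_sub (f := fun z => (z - 1)⁻¹ • (1 : B →L[ℂ] B))
      ((hcinv.smul continuousOn_const).circleIntegrable hr.le) hint,
      circleIntegral.integral_smul_const, hI1, smul_sub, inv_smul_smul₀ h2pi, ← hQdef, hQP]
  have hleft : (1 - A) * S = 1 - P := by
    have h1 := (ContinuousLinearMap.mul ℂ (B →L[ℂ] B) (1 - A)).circleIntegral_comp_comm hint2
    simp only [ContinuousLinearMap.mul_apply'] at h1
    rw [hS, mul_smul_comm, ← h1, ← hbase]
    congr 1
    refine circleIntegral.integral_congr hr.le fun z hz => ?_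
    have h2 : (algebraMap ℂ _ z - A) * resolvent A z = 1 :=
      Ring.mul_inverse_cancel _ (hres z hz).2
    have h3 : (1 - A) * resolvent A z = 1 - (z - 1) • resolvent A z := by
      rw [Algebra.algebraMap_eq_smul_one, sub_mul, smul_mul_assoc, one_mul] at h2
      rw [sub_mul, one_mul, sub_smul, one_smul, ← h2]
      abel
    simp only [mul_smul_comm, h3, smul_sub]
    rw [inv_smul_smul₀ (sub_ne_zero.2 (hres z hz).1)]
  have hright : S * (1 - A) = 1 - P := by
    have h1 := ((ContinuousLinearMap.mul ℂ (B →L[ℂ] B)).flip (1 - A)).circleIntegral_comp_comm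
      hint2
    simp only [ContinuousLinearMap.flip_apply, ContinuousLinearMap.mul_apply'] at h1
    rw [hS, smul_mul_assoc, ← h1, ← hbase]
    congr 1
    refine circleIntegral.integral_congr hr.le fun z hz => ?_
    have h2 : resolvent A z * (algebraMap ℂ _ z - A) = 1 :=
      Ring.inverse_mul_cancel _ (hres z hz).2
    have h3 : resolvent A z * (1 - A) = 1 - (z - 1) • resolvent A z := by
      rw [Algebra.algebraMap_eq_smul_one, mul_sub, mul_smul_comm, mul_one] at h2
      rw [mul_sub, mul_one, sub_smul, one_smul, ← h2]
      abel
    simp only [smul_mul_assoc, h3, smul_sub]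
    rw [inv_smul_smul₀ (sub_ne_zero.2 (hres z hz).1)]
  have hSe : S e = 0 := by
    have h1 := (ContinuousLinearMap.apply ℂ B e).circleIntegral_comp_comm hint2
    simp only [ContinuousLinearMap.apply_apply] at h1
    rw [hS, _root_.smul_apply, ← h1,
      circleIntegral.integral_congr hr.le (g := fun z => ((z - 1)⁻¹ * (z - 1)⁻¹) • e)
        fun z hz => by
          simp only [_root_.smul_apply]
          rw [resolvent_apply_eigenvector he (hres z hz).2 (hres z hz).1, smul_smul],
      circleIntegral.integral_smul_const, hI2, zero_smul, smul_zero]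
  have hψS : ∀ v, ψ (S v) = 0 := by
    intro v
    have h1 := (ψ.comp (ContinuousLinearMap.apply ℂ B v)).circleIntegral_comp_comm hint2
    simp only [ContinuousLinearMap.comp_apply, ContinuousLinearMap.apply_apply] at h1
    rw [hS, _root_.smul_apply, map_smul, ← h1,
      circleIntegral.integral_congr hr.le (g := fun z => ((z - 1)⁻¹ * (z - 1)⁻¹) • ψ v)
        fun z hz => by
          simp only [_root_.smul_apply, map_smul, smul_eq_mul]
          rw [eigenfunctional_resolvent hψ (hres z hz).2 (hres z hz).1, mul_assoc],
      circleIntegral.integral_smul_const, hI2, zero_smul, smul_zero]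
  have hPS : P * S = 0 := by
    ext v; simp [hP, hψS]
  have hSP : S * P = 0 := by
    ext v; simp [hP, hSe]
  have hPP : P * P = P := by
    ext v; simp [hP, hψe]
  have hAP : (1 - A) * P = 0 := by
    ext v; simp [hP, he]
  have hPA : P * (1 - A) = 0 := by
    ext v
    have h3 : ψ (A v) = ψ v := congrArg (fun L : B →L[ℂ] ℂ => L v) hψ
    simp [hP, h3]
  refine ⟨⟨1 - A + P, S + P, ?_, ?_⟩, rfl⟩
  · rw [add_mul, mul_add, mul_add, hleft, hAP, hPS, hPP]; abel
  · rw [add_mul, mul_add, mul_add, hright, hSP, hPA, hPP]; abel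

end SpectralProjection

section ReturnSeries

variable {B : Type*} [NormedAddCommGroup B] [NormedSpace ℂ B] [CompleteSpace B]
  {Rn : ℕ → B →L[ℂ] B} {p : ℕ → ℝ} {C : ℝ}

theorem norm_pow_sub_pow_le_mul {z w : ℂ} (hz : ‖z‖ ≤ 1) (hw : ‖w‖ ≤ 1) (n : ℕ) :
    ‖z ^ n - w ^ n‖ ≤ n * ‖z - w‖ := by
  rw [← (Commute.all z w).geom_sum₂_mul, norm_mul]
  gcongr
  refine (norm_sum_le _ _).trans ?_
  calc ∑ i ∈ Finset.range n, ‖z ^ i * w ^ (n - 1 - i)‖ ≤ ∑ i ∈ Finset.range n, (1 : ℝ) :=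
        Finset.sum_le_sum fun i _ => by
          rw [norm_mul, norm_pow, norm_pow]
          exact mul_le_one₀ (pow_le_one₀ (norm_nonneg z) hz) (by positivity)
            (pow_le_one₀ (norm_nonneg w) hw)
    _ = n := by simp

omit [CompleteSpace B] in
theorem norm_returnSeries_term_le
    (hR : ∀ j, ‖Rn (j + 1)‖ ≤ C * (p j - p (j + 1))) {z : ℂ} (hz : ‖z‖ ≤ 1) (n : ℕ) :
    ‖z ^ (n + 1) • Rn (n + 1)‖ ≤ C * (p n - p (n + 1)) := by
  rw [norm_smul, norm_pow]
  exact (mul_le_of_le_one_left (norm_nonneg _) (pow_le_one₀ (norm_nonneg z) hz)).trans (hR n)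

theorem hasSum_returnSeries (hp : RelativelyStableTail p)
    (hR : ∀ j, ‖Rn (j + 1)‖ ≤ C * (p j - p (j + 1))) {z : ℂ} (hz : ‖z‖ ≤ 1) :
    HasSum (fun n => z ^ (n + 1) • Rn (n + 1)) (returnSeries Rn z) :=
  (Summable.of_norm_bounded (hp.summable_diff.mul_left C)
    (norm_returnSeries_term_le hR hz)).hasSum

theorem continuousOn_returnSeries (hp : RelativelyStableTail p)
    (hR : ∀ j, ‖Rn (j + 1)‖ ≤ C * (p j - p (j + 1))) :
    ContinuousOn (returnSeries Rn) (Metric.closedBall 0 1) :=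
  continuousOn_tsum (fun n => by fun_prop) (hp.summable_diff.mul_left C)
    fun n z hz => norm_returnSeries_term_le hR (by simpa using hz) n

theorem differentiableOn_returnSeries (hp : RelativelyStableTail p)
    (hR : ∀ j, ‖Rn (j + 1)‖ ≤ C * (p j - p (j + 1))) :
    DifferentiableOn ℂ (returnSeries Rn) (Metric.ball 0 1) :=
  Complex.differentiableOn_tsum_of_summable_norm (hp.summable_diff.mul_left C)
    (fun n => by fun_prop) Metric.isOpen_ball
    fun n z hz => norm_returnSeries_term_le hR (by simpa using (Metric.mem_ball.1 hz).le) n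

theorem norm_returnSeries_sub_le (hp : RelativelyStableTail p) (hC : 0 < C)
    (hR : ∀ j, ‖Rn (j + 1)‖ ≤ C * (p j - p (j + 1))) {z w : ℂ} (hz : ‖z‖ ≤ 1) (hw : ‖w‖ ≤ 1)
    {N : ℕ} (hN : 1 ≤ N) :
    ‖returnSeries Rn z - returnSeries Rn w‖ ≤ C * (‖z - w‖ + 2 / N) * truncMean p N := by
  have hsum := (hasSum_returnSeries hp hR hz).sub (hasSum_returnSeries hp hR hw)
  have hN' : (0 : ℝ) < N := by exact_mod_cast hN
  have hterm : ∀ k : ℕ, ‖z ^ (k + 1) • Rn (k + 1) - w ^ (k + 1) • Rn (k + 1)‖ ≤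
      C * (‖z - w‖ + 2 / N) * ((p k - p (k + 1)) * (min (k + 1) N : ℕ)) := by
    intro k
    have hmin : ‖z ^ (k + 1) - w ^ (k + 1)‖ ≤ (‖z - w‖ + 2 / N) * (min (k + 1) N : ℕ) := by
      rcases le_total (k + 1) N with h | h
      · rw [min_eq_left h]
        have := norm_pow_sub_pow_le_mul hz hw (k + 1)
        have h2 : 0 ≤ 2 / (N : ℝ) * (k + 1 : ℕ) := by positivity
        linarith
      · rw [min_eq_right h, add_mul, div_mul_cancel₀ _ hN'.ne']
        have h1 : ‖z ^ (k + 1) - w ^ (k + 1)‖ ≤ 1 + 1 := by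
          refine (norm_sub_le _ _).trans ?_
          rw [norm_pow, norm_pow]
          exact add_le_add (pow_le_one₀ (norm_nonneg z) hz) (pow_le_one₀ (norm_nonneg w) hw)
        have h2 : 0 ≤ ‖z - w‖ * N := by positivity
        linarith
    rw [← sub_smul, norm_smul]
    calc _ ≤ ((‖z - w‖ + 2 / N) * (min (k + 1) N : ℕ)) * (C * (p k - p (k + 1))) :=
          mul_le_mul hmin (hR k) (norm_nonneg _) (by positivity)
      _ = _ := by ring
  have hs : Summable fun k => (p k - p (k + 1)) * (min (k + 1) N : ℕ) :=
    summable_of_sum_range_le (fun k => mul_nonneg (hp.diff_nonneg k) (Nat.cast_nonneg _))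
      (hp.sum_diff_mul_min_le N)
  have hle : ∑' k, (p k - p (k + 1)) * (min (k + 1) N : ℕ) ≤ truncMean p N :=
    hs.tsum_le_of_sum_range_le (hp.sum_diff_mul_min_le N)
  rw [← hsum.tsum_eq]
  refine (tsum_of_norm_bounded (hs.mul_left _).hasSum hterm).trans ?_
  rw [tsum_mul_left]
  gcongr

end ReturnSeries

/-- The operator-theoretic setting of the renewal theorem: `p` is the tail sequence of the return
time, `e` and `ψ` are the right and left eigenvectors of `R(1)`. -/
structure RenewalSetting {B : Type*} [NormedAddCommGroup B] [NormedSpace ℂ B]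
    (Rn : ℕ → B →L[ℂ] B) (p : ℕ → ℝ) (C : ℝ) (ψ : B →L[ℂ] ℂ) (e : B) : Prop where
  tail : RelativelyStableTail p
  const_pos : 0 < C
  norm_le : ∀ j, ‖Rn (j + 1)‖ ≤ C * (p j - p (j + 1))
  map_eigenvector : returnSeries Rn 1 e = e
  comp_eigenfunctional : ψ.comp (returnSeries Rn 1) = ψ
  pairing : ψ e = 1
  pairing_return : ∀ j, ψ (Rn (j + 1) e) = ((p j - p (j + 1) : ℝ) : ℂ)
  isUnit_regularized : IsUnit (1 - returnSeries Rn 1 + ψ.smulRight e)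
  isUnit_one_sub : ∀ z : ℂ, ‖z‖ ≤ 1 → z ≠ 1 → IsUnit (1 - returnSeries Rn z)

section Resolvent

variable {B : Type*} [NormedAddCommGroup B] [NormedSpace ℂ B]

/-- The generating function `(1 - R(z))⁻¹` of the renewal operators. -/
noncomputable def renewalResolvent (Rn : ℕ → B →L[ℂ] B) (z : ℂ) : B →L[ℂ] B :=
  Ring.inverse (1 - returnSeries Rn z)

/-- The inverse of `1 - R(z) + ψ.smulRight e`. -/
noncomputable def regularizedInverse (Rn : ℕ → B →L[ℂ] B) (ψ : B →L[ℂ] ℂ) (e : B) (z : ℂ) :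
    B →L[ℂ] B :=
  Ring.inverse (1 - returnSeries Rn z + ψ.smulRight e)

/-- The scalar that vanishes exactly when `1 - R(z)` is singular, for `z` near `1`. -/
noncomputable def renewalDefect (Rn : ℕ → B →L[ℂ] B) (ψ : B →L[ℂ] ℂ) (e : B) (z : ℂ) : ℂ :=
  1 - ψ (regularizedInverse Rn ψ e z e)

namespace RenewalSetting

variable [CompleteSpace B] {Rn : ℕ → B →L[ℂ] B} {p : ℕ → ℝ} {C : ℝ} {ψ : B →L[ℂ] ℂ} {e : B}
  (h : RenewalSetting Rn p C ψ e)
include h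

theorem tendsto_returnSeries :
    Tendsto (returnSeries Rn) (𝓝[Metric.closedBall 0 1] 1) (𝓝 (returnSeries Rn 1)) :=
  continuousOn_returnSeries h.tail h.norm_le 1 (by simp)

theorem tendsto_regularized :
    Tendsto (fun z => 1 - returnSeries Rn z + ψ.smulRight e) (𝓝[Metric.closedBall 0 1] 1)
      (𝓝 (1 - returnSeries Rn 1 + ψ.smulRight e)) :=
  (h.tendsto_returnSeries.const_sub 1).add_const _

theorem tendsto_regularizedInverse :
    Tendsto (regularizedInverse Rn ψ e) (𝓝[Metric.closedBall 0 1] 1)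
      (𝓝 (regularizedInverse Rn ψ e 1)) := by
  have h1 : ContinuousAt Ring.inverse (1 - returnSeries Rn 1 + ψ.smulRight e) :=
    NormedRing.inverse_continuousAt h.isUnit_regularized.unit
  exact h1.tendsto.comp h.tendsto_regularized

theorem eventually_isUnit_regularized :
    ∀ᶠ z in 𝓝[Metric.closedBall 0 1] 1, IsUnit (1 - returnSeries Rn z + ψ.smulRight e) :=
  h.tendsto_regularized.eventually (Units.isOpen.mem_nhds h.isUnit_regularized)

omit [CompleteSpace B] in
theorem regularizedInverse_one_apply : regularizedInverse Rn ψ e 1 e = e := by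
  have h1 : (1 - returnSeries Rn 1 + ψ.smulRight e) e = e := by
    simp [h.map_eigenvector, h.pairing]
  have h2 := Ring.inverse_mul_cancel _ h.isUnit_regularized
  have h3 := congrArg (fun L : B →L[ℂ] B => L e) h2
  simp only [mul_apply_eq_comp, h1, one_apply_eq_self] at h3
  exact h3

omit [CompleteSpace B] in
theorem eigenfunctional_apply (v : B) : ψ (returnSeries Rn 1 v) = ψ v :=
  congrArg (fun L : B →L[ℂ] ℂ => L v) h.comp_eigenfunctional

omit [CompleteSpace B] in
theorem eigenfunctional_regularizedInverse_one (v : B) :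
    ψ (regularizedInverse Rn ψ e 1 v) = ψ v := by
  have h1 : ∀ w, ψ ((1 - returnSeries Rn 1 + ψ.smulRight e) w) = ψ w := fun w => by
    simp [h.eigenfunctional_apply, h.pairing]
  have h2 := Ring.mul_inverse_cancel _ h.isUnit_regularized
  have h3 := congrArg (fun L : B →L[ℂ] B => ψ (L v)) h2
  simp only [mul_apply_eq_comp, h1, one_apply_eq_self] at h3
  exact h3

omit [CompleteSpace B] in
theorem renewalDefect_eq {z : ℂ} (hu : IsUnit (1 - returnSeries Rn z + ψ.smulRight e)) :
    renewalDefect Rn ψ e z =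
      ψ ((returnSeries Rn 1 - returnSeries Rn z) (regularizedInverse Rn ψ e z e)) := by
  have h2 := Ring.mul_inverse_cancel _ hu
  have h3 := congrArg (fun L : B →L[ℂ] B => ψ (L e)) h2
  simp only [mul_apply_eq_comp, one_apply_eq_self, h.pairing] at h3
  change ψ ((1 - returnSeries Rn z + ψ.smulRight e) (regularizedInverse Rn ψ e z e)) = 1 at h3
  simp only [_root_.add_apply, _root_.sub_apply, one_apply_eq_self,
    ContinuousLinearMap.smulRight_apply, map_add, map_sub, map_smul, smul_eq_mul, h.pairing,
    mul_one] at h3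
  rw [renewalDefect, _root_.sub_apply, map_sub, h.eigenfunctional_apply]
  linear_combination -h3

omit [CompleteSpace B] in
theorem renewalDefect_smul_renewalResolvent {z : ℂ} (hz : ‖z‖ ≤ 1) (hz1 : z ≠ 1)
    (hu : IsUnit (1 - returnSeries Rn z + ψ.smulRight e)) :
    renewalDefect Rn ψ e z • renewalResolvent Rn z =
      renewalDefect Rn ψ e z • regularizedInverse Rn ψ e z +
        regularizedInverse Rn ψ e z * ψ.smulRight e * regularizedInverse Rn ψ e z := by
  set d := renewalDefect Rn ψ e z with hd
  set V := regularizedInverse Rn ψ e z with hV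
  set P := ψ.smulRight e with hP
  have hNV : (1 - returnSeries Rn z + P) * V = 1 := Ring.mul_inverse_cancel _ hu
  have hAV : (1 - returnSeries Rn z) * V = 1 - P * V := by
    rw [eq_sub_iff_add_eq, ← add_mul, hNV]
  have hPVP : P * V * P = (1 - d) • P := by
    ext v
    simp [hP, hd, renewalDefect, ← hV, smul_smul, mul_comm]
  have hT : renewalResolvent Rn z * (1 - returnSeries Rn z) = 1 :=
    Ring.inverse_mul_cancel _ (h.isUnit_one_sub z hz hz1)
  have key : (1 - returnSeries Rn z) * (d • V + V * P * V) = d • 1 := by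
    have e1 : (1 - returnSeries Rn z) * (V * P * V) = P * V - P * V * P * V := by
      rw [← mul_assoc, ← mul_assoc, hAV, sub_mul, sub_mul, one_mul]
    rw [mul_add, mul_smul_comm, hAV, e1, hPVP, smul_mul_assoc, sub_smul, one_smul, smul_sub]
    abel
  calc d • renewalResolvent Rn z = renewalResolvent Rn z * (d • 1) := by simp
    _ = d • V + V * P * V := by rw [← key, ← mul_assoc, hT, one_mul]

theorem eigenfunctional_sub_returnSeries {z : ℂ} (hz : ‖z‖ < 1) :
    ψ ((returnSeries Rn 1 - returnSeries Rn z) e) = (1 - z) * ∑' k, (p k : ℂ) * z ^ k := by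
  rw [_root_.sub_apply, map_sub, h.eigenfunctional_apply, h.pairing,
    ← h.tail.one_sub_tsum_diff hz]
  congr 1
  have h1 := (ψ.comp (ContinuousLinearMap.apply ℂ B e)).hasSum
    (hasSum_returnSeries h.tail h.norm_le hz.le)
  simp only [ContinuousLinearMap.comp_apply, ContinuousLinearMap.apply_apply,
    map_smul, h.pairing_return, smul_eq_mul] at h1
  rw [← h1.tsum_eq]
  exact tsum_congr fun k => mul_comm _ _

theorem norm_renewalDefect_div_sub_one_le {z : ℂ} (hz : ‖z‖ < 1)
    (hu : IsUnit (1 - returnSeries Rn z + ψ.smulRight e)) {N : ℕ} (hN : 1 ≤ N) :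
    ‖renewalDefect Rn ψ e z / ((1 - z) * truncMean p N) - 1‖ ≤
      N * ‖1 - z‖ * ((∑ k ∈ Finset.range N, k * p k) / (N * truncMean p N)) +
      2 * (N * p N / truncMean p N) / (N * ‖1 - z‖) +
      ‖ψ‖ * C * (1 + 2 / (N * ‖1 - z‖)) * ‖regularizedInverse Rn ψ e z e - e‖ := by
  have hz1 : z ≠ 1 := by rintro rfl; simp at hz
  have hz1' : 1 - z ≠ 0 := sub_ne_zero.2 hz1.symm
  have hq : 0 < ‖1 - z‖ := norm_pos_iff.2 hz1'
  have hM := h.tail.truncMean_pos hN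
  have hN' : (0 : ℝ) < N := by exact_mod_cast hN
  have hMc : (truncMean p N : ℂ) ≠ 0 := by exact_mod_cast hM.ne'
  set g := regularizedInverse Rn ψ e z e with hg
  set q := ‖1 - z‖ with hqd
  have hd : renewalDefect Rn ψ e z = (1 - z) * ∑' k, (p k : ℂ) * z ^ k +
      ψ ((returnSeries Rn 1 - returnSeries Rn z) (g - e)) := by
    rw [h.renewalDefect_eq hu, ← h.eigenfunctional_sub_returnSeries hz, ← map_add, ← map_add]
    congr 2
    abel
  have h1 := h.tail.norm_tsum_sub_truncMean_le hz N
  have h2 : ‖ψ ((returnSeries Rn 1 - returnSeries Rn z) (g - e))‖ ≤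
      ‖ψ‖ * (C * (q + 2 / N) * truncMean p N * ‖g - e‖) := by
    refine (ψ.le_opNorm _).trans ?_
    gcongr
    refine (ContinuousLinearMap.le_opNorm _ _).trans ?_
    gcongr
    exact norm_returnSeries_sub_le h.tail h.const_pos h.norm_le (by simp) hz.le hN
  have h3 : renewalDefect Rn ψ e z / ((1 - z) * truncMean p N) - 1 =
      (∑' k, (p k : ℂ) * z ^ k - truncMean p N) / truncMean p N +
        ψ ((returnSeries Rn 1 - returnSeries Rn z) (g - e)) / ((1 - z) * truncMean p N) := by
    rw [hd]; field_simp; ring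
  rw [h3]
  refine (norm_add_le _ _).trans ?_
  rw [norm_div, norm_div, norm_mul, Complex.norm_of_nonneg hM.le]
  calc _ ≤ (q * ∑ k ∈ Finset.range N, k * p k + 2 * p N / q) / truncMean p N +
        ‖ψ‖ * (C * (q + 2 / N) * truncMean p N * ‖g - e‖) / (q * truncMean p N) := by gcongr
    _ = _ := by field_simp

theorem tendsto_renewalDefect_div {α : Type*} {F : Filter α} {z : α → ℂ} {N : α → ℕ} {a b : ℝ}
    (ha : 0 < a) (hz : Tendsto z F (𝓝 1)) (hz1 : ∀ᶠ i in F, ‖z i‖ < 1)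
    (hN : Tendsto N F atTop) (hNa : ∀ᶠ i in F, a ≤ N i * ‖1 - z i‖)
    (hNb : ∀ᶠ i in F, N i * ‖1 - z i‖ ≤ b) :
    Tendsto (fun i => renewalDefect Rn ψ e (z i) / ((1 - z i) * truncMean p (N i))) F (𝓝 1) := by
  have hzw : Tendsto z F (𝓝[Metric.closedBall 0 1] 1) :=
    tendsto_nhdsWithin_iff.2 ⟨hz, hz1.mono fun i hi => by simpa using hi.le⟩
  have hA := h.tail.tendsto_sum_mul_div.comp hN
  have hB := h.tail.tendsto_ratio.comp hN
  have hg : Tendsto (fun i => ‖regularizedInverse Rn ψ e (z i) e - e‖) F (𝓝 0) := by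
    have h1 := ((ContinuousLinearMap.apply ℂ B e).continuous.tendsto _).comp
      (h.tendsto_regularizedInverse.comp hzw)
    simp only [ContinuousLinearMap.apply_apply, h.regularizedInverse_one_apply] at h1
    simpa using (h1.sub_const e).norm
  rw [tendsto_iff_norm_sub_tendsto_zero]
  refine squeeze_zero' (g := fun i =>
      b * ((∑ k ∈ Finset.range (N i), k * p k) / (N i * truncMean p (N i))) +
      2 * (N i * p (N i) / truncMean p (N i)) / a +
      ‖ψ‖ * C * (1 + 2 / a) * ‖regularizedInverse Rn ψ e (z i) e - e‖)
    (Eventually.of_forall fun i => norm_nonneg _) ?_ ?_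
  · filter_upwards [hz1, hNa, hNb, hN.eventually (eventually_ge_atTop 1),
      hzw.eventually h.eventually_isUnit_regularized] with i h1 h2 h3 h4 h5
    refine (h.norm_renewalDefect_div_sub_one_le h1 h5 h4).trans ?_
    have hM := h.tail.truncMean_pos h4
    have hs : 0 ≤ ∑ k ∈ Finset.range (N i), k * p k :=
      Finset.sum_nonneg fun k _ => mul_nonneg k.cast_nonneg (h.tail.nonneg k)
    have hpn := h.tail.nonneg (N i)
    have hC := h.const_pos
    gcongr
  · simpa using ((hA.const_mul b).add ((hB.const_mul 2).div_const a)).add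
      (hg.const_mul (‖ψ‖ * C * (1 + 2 / a)))

theorem tendsto_renewalDefect : Tendsto (renewalDefect Rn ψ e) (𝓝[Metric.closedBall 0 1] 1)
    (𝓝 0) := by
  have h1 := ((ψ.comp (ContinuousLinearMap.apply ℂ B e)).continuous.tendsto _).comp
    h.tendsto_regularizedInverse
  simp only [ContinuousLinearMap.comp_apply, ContinuousLinearMap.apply_apply,
    h.regularizedInverse_one_apply, h.pairing] at h1
  have h2 := h1.const_sub 1
  rw [sub_self] at h2
  exact h2

theorem tendsto_renewalDefect_smul_renewalResolvent :
    Tendsto (fun z => renewalDefect Rn ψ e z • renewalResolvent Rn z)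
      (𝓝[Metric.ball 0 1] 1) (𝓝 (ψ.smulRight e)) := by
  have hle : 𝓝[Metric.ball (0 : ℂ) 1] 1 ≤ 𝓝[Metric.closedBall 0 1] 1 :=
    nhdsWithin_mono _ Metric.ball_subset_closedBall
  have hV := h.tendsto_regularizedInverse.mono_left hle
  have hd := h.tendsto_renewalDefect.mono_left hle
  have hlim := (hd.smul hV).add ((hV.mul_const (ψ.smulRight e)).mul hV)
  have hval : (0 : ℂ) • regularizedInverse Rn ψ e 1 +
      regularizedInverse Rn ψ e 1 * ψ.smulRight e * regularizedInverse Rn ψ e 1 =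
        ψ.smulRight e := by
    ext v
    simp [h.regularizedInverse_one_apply, h.eigenfunctional_regularizedInverse_one]
  rw [hval] at hlim
  refine hlim.congr' ?_
  filter_upwards [self_mem_nhdsWithin, hle h.eventually_isUnit_regularized] with z hz hu
  have hz' : ‖z‖ < 1 := by simpa using hz
  exact (h.renewalDefect_smul_renewalResolvent hz'.le (by rintro rfl; simp at hz') hu).symm

end RenewalSetting

end Resolvent

theorem tendsto_natCast_mul_one_sub_exp (c : ℂ) :
    Tendsto (fun n : ℕ => (n : ℂ) * (1 - Complex.exp (-c / n))) atTop (𝓝 c) := by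
  rcases eq_or_ne c 0 with rfl | hc
  · simp
  have h1 := (Complex.hasDerivAt_exp 0).tendsto_slope_zero
  have h2 : Tendsto (fun n : ℕ => -c / (n : ℂ)) atTop (𝓝[≠] 0) := by
    refine tendsto_nhdsWithin_iff.2 ⟨?_, ?_⟩
    · simpa [div_eq_mul_inv] using
        (tendsto_inv_atTop_nhds_zero_nat (𝕜 := ℂ)).const_mul (-c)
    · filter_upwards [eventually_ge_atTop 1] with n hn
      have : (n : ℂ) ≠ 0 := by exact_mod_cast (by omega : n ≠ 0)
      simpa [hc] using this
  have h3 := (h1.comp h2).const_mul c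
  simp only [zero_add, Complex.exp_zero, mul_one] at h3
  refine h3.congr' ?_
  filter_upwards [eventually_ge_atTop 1] with n hn
  have : (n : ℂ) ≠ 0 := by exact_mod_cast (by omega : n ≠ 0)
  simp only [Function.comp_apply, smul_eq_mul]
  field_simp
  ring

theorem norm_exp_neg_div_lt_one {c : ℂ} (hc : 0 < c.re) {n : ℕ} (hn : 1 ≤ n) :
    ‖Complex.exp (-c / n)‖ < 1 := by
  have hn' : (0 : ℝ) < n := by exact_mod_cast hn
  rw [Complex.norm_exp, Complex.div_natCast_re, Complex.neg_re, Real.exp_lt_one_iff]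
  exact div_neg_of_neg_of_pos (by linarith) hn'

namespace RenewalSetting

variable {B : Type*} [NormedAddCommGroup B] [NormedSpace ℂ B] [CompleteSpace B]
  {Rn : ℕ → B →L[ℂ] B} {p : ℕ → ℝ} {C : ℝ} {ψ : B →L[ℂ] ℂ} {e : B}
  (h : RenewalSetting Rn p C ψ e)
include h

theorem tendsto_renewalResolvent_exp {c : ℂ} (hc : 0 < c.re) :
    Tendsto (fun n : ℕ => ((truncMean p n / n : ℝ) : ℂ) •
      renewalResolvent Rn (Complex.exp (-c / n))) atTop (𝓝 (c⁻¹ • ψ.smulRight e)) := by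
  have hc0 : c ≠ 0 := by rintro rfl; simp at hc
  set z : ℕ → ℂ := fun n => Complex.exp (-c / n) with hzdef
  have hlin : Tendsto (fun n : ℕ => (n : ℂ) * (1 - z n)) atTop (𝓝 c) :=
    tendsto_natCast_mul_one_sub_exp c
  have hz : Tendsto z atTop (𝓝 1) := by
    have h2 : Tendsto (fun n : ℕ => -c / (n : ℂ)) atTop (𝓝 0) := by
      simpa [div_eq_mul_inv] using
        (tendsto_inv_atTop_nhds_zero_nat (𝕜 := ℂ)).const_mul (-c)
    have h3 := (Complex.continuous_exp.tendsto 0).comp h2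
    rwa [Complex.exp_zero] at h3
  have hz1 : ∀ᶠ n in atTop, ‖z n‖ < 1 := by
    filter_upwards [eventually_ge_atTop 1] with n hn
    exact norm_exp_neg_div_lt_one hc hn
  have hnorm : Tendsto (fun n : ℕ => (n : ℝ) * ‖1 - z n‖) atTop (𝓝 ‖c‖) := by
    simpa using hlin.norm
  have hcn : 0 < ‖c‖ := norm_pos_iff.2 hc0
  have hd := h.tendsto_renewalDefect_div (N := fun n => n) (a := ‖c‖ / 2) (b := 2 * ‖c‖)
    (by positivity) hz hz1 tendsto_id
    (hnorm.eventually_const_le (by linarith)) (hnorm.eventually_le_const (by linarith))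
  have hzw : Tendsto z atTop (𝓝[Metric.ball 0 1] 1) :=
    tendsto_nhdsWithin_iff.2 ⟨hz, hz1.mono fun i hi => by simpa using hi⟩
  have hT := h.tendsto_renewalDefect_smul_renewalResolvent.comp hzw
  have hlim := ((hd.inv₀ one_ne_zero).mul (hlin.inv₀ hc0)).smul hT
  rw [inv_one, one_mul] at hlim
  refine hlim.congr' ?_
  filter_upwards [hd.eventually_ne one_ne_zero, eventually_ge_atTop 1, hz1] with n h1 h2 h3
  have hn : (n : ℂ) ≠ 0 := by exact_mod_cast (by omega : n ≠ 0)
  have hM : (truncMean p n : ℂ) ≠ 0 := by exact_mod_cast (h.tail.truncMean_pos h2).ne'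
  have hzn : 1 - z n ≠ 0 := by
    rw [sub_ne_zero]; intro heq; rw [← heq] at h3; simp at h3
  have hdn : renewalDefect Rn ψ e (z n) ≠ 0 := by
    intro h0; rw [h0, zero_div] at h1; exact h1 rfl
  simp only [Function.comp_apply]
  rw [smul_smul]
  congr 1
  push_cast
  field_simp

theorem continuousOn_renewalResolvent :
    ContinuousOn (renewalResolvent Rn) (Metric.closedBall 0 1 \ {1}) := by
  intro z hz
  have hz' : ‖z‖ ≤ 1 := by simpa using hz.1
  have h1 : ContinuousAt Ring.inverse (1 - returnSeries Rn z) :=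
    NormedRing.inverse_continuousAt (h.isUnit_one_sub z hz' hz.2).unit
  have h2 : ContinuousWithinAt (fun w => 1 - returnSeries Rn w) (Metric.closedBall 0 1 \ {1}) z :=
    continuousWithinAt_const.sub
      (((continuousOn_returnSeries h.tail h.norm_le) z hz.1).mono Set.sdiff_subset)
  exact h1.comp_continuousWithinAt (f := fun w => 1 - returnSeries Rn w) h2

theorem exists_norm_renewalResolvent_near_one : ∃ K δ : ℝ, 0 < K ∧ 0 < δ ∧ δ ≤ 1 ∧
    ∀ z : ℂ, ‖z‖ < 1 → ‖1 - z‖ < δ →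
      ‖renewalResolvent Rn z‖ * (‖1 - z‖ * truncMean p ⌊1 / ‖1 - z‖⌋₊) ≤ K := by
  set F : Filter ℂ := 𝓝[Metric.ball 0 1] 1 with hF
  have hz : Tendsto (fun z : ℂ => z) F (𝓝 1) := tendsto_id.mono_left nhdsWithin_le_nhds
  have hz1 : ∀ᶠ z in F, ‖z‖ < 1 := by
    filter_upwards [self_mem_nhdsWithin] with z hz
    simpa using hz
  have hq0 : Tendsto (fun z : ℂ => ‖1 - z‖) F (𝓝[>] 0) := by
    refine tendsto_nhdsWithin_iff.2 ⟨by simpa using (hz.const_sub 1).norm, ?_⟩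
    filter_upwards [hz1] with z hz
    refine norm_pos_iff.2 (sub_ne_zero.2 ?_)
    rintro rfl; simp at hz
  have hqinv : Tendsto (fun z : ℂ => 1 / ‖1 - z‖) F atTop := by
    simp only [one_div]
    exact tendsto_inv_nhdsGT_zero.comp hq0
  have hN : Tendsto (fun z : ℂ => ⌊1 / ‖1 - z‖⌋₊) F atTop := tendsto_nat_floor_atTop.comp hqinv
  have hq1 : ∀ᶠ z in F, 0 < ‖1 - z‖ ∧ ‖1 - z‖ < 1 / 2 := by
    have := hq0.eventually (Ioo_mem_nhdsGT (by norm_num : (0 : ℝ) < 1 / 2))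
    exact this
  have hd := h.tendsto_renewalDefect_div (a := 1 / 2) (b := 1) (by norm_num) hz hz1 hN
    (by
      filter_upwards [hq1] with z hq
      have h1 := Nat.lt_floor_add_one (1 / ‖1 - z‖)
      rw [div_lt_iff₀ hq.1] at h1
      linarith)
    (by
      filter_upwards [hq1] with z hq
      have h1 := Nat.floor_le (by positivity : 0 ≤ 1 / ‖1 - z‖)
      rwa [le_div_iff₀ hq.1] at h1)
  have hT := h.tendsto_renewalDefect_smul_renewalResolvent.norm
  have hev : ∀ᶠ z in F, ‖renewalResolvent Rn z‖ *
      (‖1 - z‖ * truncMean p ⌊1 / ‖1 - z‖⌋₊) ≤ 2 * (‖ψ.smulRight e‖ + 1) := by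
    filter_upwards [hT.eventually_lt_const (lt_add_one _), hq1,
      hd.norm.eventually_const_lt (by norm_num : (1 / 2 : ℝ) < ‖(1 : ℂ)‖),
      hN.eventually (eventually_ge_atTop 1)] with z h1 h2 h3 h4
    have hM := h.tail.truncMean_pos h4
    rw [norm_div, norm_mul, Complex.norm_of_nonneg hM.le,
      lt_div_iff₀ (mul_pos h2.1 hM)] at h3
    rw [norm_smul] at h1
    have h5 := mul_le_mul_of_nonneg_left h3.le (norm_nonneg (renewalResolvent Rn z))
    linarith
  obtain ⟨δ, hδ, hsub⟩ := Metric.mem_nhdsWithin_iff.1 hev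
  refine ⟨2 * (‖ψ.smulRight e‖ + 1), min δ 1, by positivity, by positivity, min_le_right _ _,
    fun z hz hzδ => hsub ⟨?_, by simpa using hz⟩⟩
  rw [Metric.mem_ball, dist_comm, dist_eq_norm]
  exact hzδ.trans_le (min_le_left _ _)

theorem exists_norm_renewalResolvent_pow_le : ∃ K : ℝ, 0 < K ∧
    ∀ (z : ℂ) (n : ℕ), ‖z‖ < 1 → 1 ≤ n → 1 / 2 ≤ n * ‖1 - z‖ →
      ‖renewalResolvent Rn z‖ ^ 4 * truncMean p n ^ 4 * (n * ‖1 - z‖) ^ 3 ≤ K * n ^ 4 := by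
  obtain ⟨K₁, δ, hK₁, hδ, hδ1, hnear⟩ := h.exists_norm_renewalResolvent_near_one
  obtain ⟨C₁, hC₁, hpot⟩ := h.tail.exists_truncMean_pow_le
  have hcpt : IsCompact (Metric.closedBall (0 : ℂ) 1 \ Metric.ball 1 δ) :=
    (isCompact_closedBall 0 1).diff Metric.isOpen_ball
  obtain ⟨K₂, hK₂⟩ := hcpt.exists_bound_of_continuousOn
    (h.continuousOn_renewalResolvent.mono
      (Set.sdiff_subset_sdiff_right (Set.singleton_subset_iff.2 (Metric.mem_ball_self hδ))))
  refine ⟨4 * C₁ * K₁ ^ 4 + 16 * C₁ * K₂ ^ 4, by positivity, fun z n hz hn hnq => ?_⟩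
  set q := ‖1 - z‖ with hq
  set t := ‖renewalResolvent Rn z‖ with ht
  have hn' : (1 : ℝ) ≤ n := by exact_mod_cast hn
  have ht0 : 0 ≤ t := norm_nonneg _
  have hq0 : 0 < q := by
    by_contra hcon
    have : q = 0 := le_antisymm (not_lt.1 hcon) (norm_nonneg _)
    rw [this] at hnq; norm_num at hnq
  have hM := h.tail.truncMean_pos hn
  rcases lt_or_ge q δ with hqd | hqd
  · have h1 := hnear z hz hqd
    set N := ⌊1 / q⌋₊ with hN
    have hN1 : 1 ≤ N := by
      rw [hN, Nat.one_le_floor_iff, le_div_iff₀ hq0]; linarith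
    have hN' : (1 : ℝ) ≤ N := by exact_mod_cast hN1
    have hNq : 1 ≤ 2 * q * N := by
      have h2 := Nat.lt_floor_add_one (1 / q)
      rw [div_lt_iff₀ hq0] at h2
      nlinarith
    have hMN := h.tail.truncMean_pos hN1
    have h3 : truncMean p n ^ 4 ≤ C₁ * (4 * (n * q)) * truncMean p N ^ 4 := by
      refine (hpot n N hn hN1).trans ?_
      gcongr
      have : (n : ℝ) / N ≤ n * (2 * q) := by
        rw [div_le_iff₀ (by linarith)]
        nlinarith
      linarith
    have h4 : (t * (q * truncMean p N)) ^ 4 ≤ K₁ ^ 4 := by gcongr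
    calc t ^ 4 * truncMean p n ^ 4 * (n * q) ^ 3
        ≤ t ^ 4 * (C₁ * (4 * (n * q)) * truncMean p N ^ 4) * (n * q) ^ 3 := by gcongr
      _ = 4 * C₁ * (t * (q * truncMean p N)) ^ 4 * n ^ 4 := by ring
      _ ≤ 4 * C₁ * K₁ ^ 4 * n ^ 4 := by gcongr
      _ ≤ _ := by
        gcongr
        have : 0 ≤ 16 * C₁ * K₂ ^ 4 := by positivity
        linarith
  · have h1 : t ≤ K₂ := hK₂ z ⟨by simpa using hz.le, by
      rw [Metric.mem_ball, dist_comm, dist_eq_norm]; exact not_lt.2 hqd⟩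
    have hq2 : q ≤ 2 := by
      refine (norm_sub_le _ _).trans ?_
      rw [norm_one]; linarith
    have h3 : truncMean p n ^ 4 ≤ C₁ * (2 * n) := by
      refine (hpot n 1 hn le_rfl).trans ?_
      simp only [truncMean, Finset.sum_range_one, h.tail.zero, Nat.cast_one, div_one, one_pow,
        mul_one]
      gcongr
      linarith
    calc t ^ 4 * truncMean p n ^ 4 * (n * q) ^ 3
        ≤ K₂ ^ 4 * (C₁ * (2 * n)) * (n * 2) ^ 3 := by gcongr
      _ = 16 * C₁ * K₂ ^ 4 * n ^ 4 := by ring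
      _ ≤ _ := by
        gcongr
        have : 0 ≤ 4 * C₁ * K₁ ^ 4 := by positivity
        linarith

end RenewalSetting

section TaylorCoefficients

variable {E : Type*} [NormedAddCommGroup E] [NormedSpace ℂ E] [CompleteSpace E]
  {f : ℂ → E} {a : ℕ → E}

theorem taylorCoeff_eq_circleIntegral (hf : DifferentiableOn ℂ f (Metric.ball 0 1))
    (ha : ∀ᶠ z in 𝓝 (0 : ℂ), HasSum (fun k => z ^ k • a k) (f z)) {r : ℝ} (hr : 0 < r)
    (hr1 : r < 1) (n : ℕ) :
    a n = (2 * Real.pi * Complex.I : ℂ)⁻¹ • ∮ z in C(0, r), (1 / z) ^ n • z⁻¹ • f z := by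
  lift r to NNReal using hr.le
  have h1 := (DifferentiableOn.hasFPowerSeriesOnBall
    (hf.mono (Metric.closedBall_subset_ball hr1)) (by exact_mod_cast hr)).hasFPowerSeriesAt
  set q : FormalMultilinearSeries ℂ ℂ E :=
    fun n => ContinuousMultilinearMap.mkPiRing ℂ (Fin n) (a n) with hq
  have hcoeff : ∀ n, q.coeff n = a n := fun n => by
    simp [FormalMultilinearSeries.coeff, hq]
  have h2 : HasFPowerSeriesAt f q 0 := by
    rw [hasFPowerSeriesAt_iff]
    simpa only [hcoeff, zero_add] using ha
  have h3 := h1.eq_formalMultilinearSeries h2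
  have h4 := cauchyPowerSeries_apply f 0 r n 1
  rw [h3] at h4
  simp only [sub_zero] at h4
  rw [← h4, ← hcoeff n]
  rfl

theorem taylorCoeff_eq_integral (hf : DifferentiableOn ℂ f (Metric.ball 0 1))
    (ha : ∀ᶠ z in 𝓝 (0 : ℂ), HasSum (fun k => z ^ k • a k) (f z)) {r : ℝ} (hr : 0 < r)
    (hr1 : r < 1) (n : ℕ) :
    ((2 * Real.pi : ℝ) : ℂ) • (r : ℂ) ^ n • a n =
      ∫ θ in (0 : ℝ)..2 * Real.pi,
        Complex.exp (-(n * θ * Complex.I)) • f (circleMap 0 r θ) := by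
  rw [taylorCoeff_eq_circleIntegral hf ha hr hr1 n, circleIntegral, ← intervalIntegral.integral_smul,
    ← intervalIntegral.integral_smul, ← intervalIntegral.integral_smul]
  refine intervalIntegral.integral_congr fun θ _ => ?_
  simp only [deriv_circleMap, smul_smul]
  congr 1
  have hexp : Complex.exp (θ * Complex.I) ≠ 0 := Complex.exp_ne_zero _
  have hr' : (r : ℂ) ≠ 0 := by exact_mod_cast hr.ne'
  have hpi : (Real.pi : ℂ) ≠ 0 := by exact_mod_cast Real.pi_ne_zero
  have hn : Complex.exp (-(n * θ * Complex.I)) = (Complex.exp (θ * Complex.I) ^ n)⁻¹ := by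
    rw [← Complex.exp_nat_mul, ← Complex.exp_neg]; congr 1; ring
  rw [hn, circleMap, zero_add, one_div, inv_pow, mul_pow]
  push_cast
  field_simp

theorem two_smul_taylorCoeff_eq_integral (hf : DifferentiableOn ℂ f (Metric.ball 0 1))
    (ha : ∀ᶠ z in 𝓝 (0 : ℂ), HasSum (fun k => z ^ k • a k) (f z)) {r : ℝ} (hr : 0 < r)
    (hr1 : r < 1) {n : ℕ} (hn : 1 ≤ n) :
    (2 : ℂ) • ((2 * Real.pi : ℝ) : ℂ) • (r : ℂ) ^ n • a n =
      ∫ θ in (-Real.pi)..Real.pi, Complex.exp (-(n * θ * Complex.I)) •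
        (f (circleMap 0 r θ) - f (circleMap 0 r (θ + Real.pi / n))) := by
  have hn' : (n : ℂ) ≠ 0 := by exact_mod_cast (by omega : n ≠ 0)
  set J : ℝ → E := fun θ => Complex.exp (-(n * θ * Complex.I)) • f (circleMap 0 r θ) with hJ
  have hper : Function.Periodic J (2 * Real.pi) := by
    intro θ
    simp only [hJ, periodic_circleMap 0 r θ]
    congr 1
    have : -((n : ℂ) * ((θ + 2 * Real.pi : ℝ) : ℂ) * Complex.I) =
        -(n * θ * Complex.I) - n * (2 * Real.pi * Complex.I) := by push_cast; ring
    rw [this, Complex.exp_sub, Complex.exp_nat_mul_two_pi_mul_I, div_one]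
  have hcont : Continuous J := by
    have h1 : Continuous fun θ : ℝ => f (circleMap 0 r θ) :=
      hf.continuousOn.comp_continuous (continuous_circleMap 0 r) fun θ => by
        simpa [abs_of_pos hr] using hr1
    exact (by fun_prop : Continuous fun θ : ℝ => Complex.exp (-(n * θ * Complex.I))).smul h1
  have h0 := taylorCoeff_eq_integral hf ha hr hr1 n
  have h1 : ∫ θ in (0 : ℝ)..2 * Real.pi, J θ = ∫ θ in (-Real.pi)..Real.pi, J θ := by
    have := hper.intervalIntegral_add_eq 0 (-Real.pi)
    rw [zero_add] at this
    rw [this]; congr 1; ring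
  have h2 : ∫ θ in (-Real.pi)..Real.pi, J (θ + Real.pi / n) =
      ∫ θ in (-Real.pi)..Real.pi, J θ := by
    rw [intervalIntegral.integral_comp_add_right]
    have := hper.intervalIntegral_add_eq (-Real.pi + Real.pi / n) (-Real.pi)
    convert this using 2 <;> ring
  rw [h0, h1, two_smul]
  nth_rw 2 [← h2]
  rw [← intervalIntegral.integral_add (hcont.intervalIntegrable _ _)
    (Continuous.intervalIntegrable (u := fun θ => J (θ + Real.pi / n))
      (hcont.comp (continuous_add_const _)) _ _)]
  refine intervalIntegral.integral_congr fun θ _ => ?_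
  have h3 : Complex.exp (-(n * ((θ + Real.pi / n : ℝ) : ℂ) * Complex.I)) =
      -Complex.exp (-(n * θ * Complex.I)) := by
    have : -((n : ℂ) * ((θ + Real.pi / n : ℝ) : ℂ) * Complex.I) =
        -(n * θ * Complex.I) - Real.pi * Complex.I := by
      push_cast; field_simp; ring
    rw [this, Complex.exp_sub, Complex.exp_pi_mul_I, div_neg, div_one]
  simp only [hJ, h3, smul_sub, neg_smul]
  abel

/-- The `n`-th Taylor coefficient is controlled by the oscillation of the function, at scale
`π / n`, on the circle of radius `exp (-1 / n)`. -/
theorem norm_taylorCoeff_le_integral (hf : DifferentiableOn ℂ f (Metric.ball 0 1))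
    (ha : ∀ᶠ z in 𝓝 (0 : ℂ), HasSum (fun k => z ^ k • a k) (f z)) {n : ℕ} (hn : 1 ≤ n) :
    ‖a n‖ ≤ ∫ u in (-(n * Real.pi))..(n * Real.pi), (n : ℝ)⁻¹ *
      ‖f (Complex.exp (-(1 - u * Complex.I) / n)) -
        f (Complex.exp (-(1 - (u + Real.pi : ℝ) * Complex.I) / n))‖ := by
  have hn0 : (0 : ℝ) < n := by exact_mod_cast hn
  have hnc : (n : ℂ) ≠ 0 := by exact_mod_cast hn0.ne'
  set r : ℝ := Real.exp (-1 / n) with hr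
  have hr0 : 0 < r := Real.exp_pos _
  have hr1 : r < 1 := Real.exp_lt_one_iff.2 (div_neg_of_neg_of_pos (by norm_num) hn0)
  have hmap : ∀ u : ℝ, Complex.exp (-(1 - u * Complex.I) / n) = circleMap 0 r (u / n) := by
    intro u
    rw [circleMap, zero_add, hr, Complex.ofReal_exp, ← Complex.exp_add]
    congr 1; push_cast; field_simp; ring
  have h1 := two_smul_taylorCoeff_eq_integral hf ha hr0 hr1 hn
  set g : ℝ → ℝ := fun θ => ‖f (circleMap 0 r θ) - f (circleMap 0 r (θ + Real.pi / n))‖ with hg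
  have h2 : ‖(2 : ℂ) • ((2 * Real.pi : ℝ) : ℂ) • (r : ℂ) ^ n • a n‖ ≤
      ∫ θ in (-Real.pi)..Real.pi, g θ := by
    rw [h1]
    refine (intervalIntegral.norm_integral_le_integral_norm
      (by linarith [Real.pi_pos])).trans_eq ?_
    refine intervalIntegral.integral_congr fun θ _ => ?_
    simp only [norm_smul, hg]
    have : ‖Complex.exp (-(n * θ * Complex.I))‖ = 1 := by
      rw [Complex.norm_exp]; simp
    rw [this, one_mul]
  have h3 : ∫ u in (-(n * Real.pi))..(n * Real.pi), (n : ℝ)⁻¹ *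
      ‖f (Complex.exp (-(1 - u * Complex.I) / n)) -
        f (Complex.exp (-(1 - (u + Real.pi : ℝ) * Complex.I) / n))‖ =
      ∫ θ in (-Real.pi)..Real.pi, g θ := by
    simp only [hmap, add_div]
    rw [intervalIntegral.integral_const_mul]
    change _ * ∫ u in (-(n * Real.pi))..(n * Real.pi), g (u / n) = _
    rw [intervalIntegral.integral_comp_div _ hn0.ne', smul_eq_mul, inv_mul_cancel_left₀ hn0.ne']
    congr 1 <;> field_simp
  rw [h3]
  refine le_trans ?_ h2
  have hrn : r ^ n = Real.exp (-1) := by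
    rw [hr, ← Real.exp_nat_mul]; congr 1; field_simp
  rw [norm_smul, norm_smul, norm_smul, norm_pow, Complex.norm_of_nonneg hr0.le, hrn,
    Complex.norm_of_nonneg (by positivity), Complex.norm_ofNat]
  have hb : 1 ≤ 2 * (2 * Real.pi * Real.exp (-1)) := by
    have h4 : Real.exp 1 < 3 := Real.exp_one_lt_d9.trans (by norm_num)
    have h5 := Real.exp_pos 1
    have h6 := Real.pi_gt_three
    rw [Real.exp_neg, ← div_eq_mul_inv, ← mul_div_assoc, le_div_iff₀ h5]
    linarith
  calc ‖a n‖ ≤ 2 * (2 * Real.pi * Real.exp (-1)) * ‖a n‖ :=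
        le_mul_of_one_le_left (norm_nonneg _) hb
    _ = _ := by ring

end TaylorCoefficients

section GeneratingFunction

variable {B : Type*} [NormedAddCommGroup B] [NormedSpace ℂ B]
  {Rn : ℕ → B →L[ℂ] B}

theorem renewalOperator_succ (Rn : ℕ → B →L[ℂ] B) (n : ℕ) :
    renewalOperator Rn (n + 1) =
      ∑ j ∈ Finset.range (n + 1), renewalOperator Rn (n - j) * Rn (j + 1) := by
  rw [renewalOperator, Finset.sum_range]
  rfl

theorem norm_renewalOperator_le {C : ℝ} (hC : 0 ≤ C) (hR : ∀ j, ‖Rn (j + 1)‖ ≤ C) (n : ℕ) :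
    ‖renewalOperator Rn n‖ ≤ (1 + C) ^ n := by
  induction n using Nat.strong_induction_on with
  | _ n ih =>
    cases n with
    | zero =>
      rw [renewalOperator, pow_zero]
      exact ContinuousLinearMap.norm_id_le
    | succ n =>
      rw [renewalOperator_succ]
      calc ‖∑ j ∈ Finset.range (n + 1), renewalOperator Rn (n - j) * Rn (j + 1)‖
          ≤ ∑ j ∈ Finset.range (n + 1), (1 + C) ^ (n - j) * C := by
            refine (norm_sum_le _ _).trans (Finset.sum_le_sum fun j _ => ?_)
            exact (norm_mul_le _ _).trans
              (mul_le_mul (ih _ (by omega)) (hR j) (norm_nonneg _) (by positivity))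
        _ = ∑ j ∈ Finset.range (n + 1), (1 + C) ^ j * C := by
            have := Finset.sum_range_reflect (fun j => (1 + C) ^ j * C) (n + 1)
            simpa using this
        _ = (1 + C) ^ (n + 1) - 1 := by
            rw [← Finset.sum_mul]
            have := geom_sum_mul (1 + C) (n + 1)
            rwa [add_sub_cancel_left] at this
        _ ≤ _ := by linarith

theorem RenewalSetting.eventually_hasSum_renewalOperator [CompleteSpace B] {p : ℕ → ℝ} {C : ℝ}
    {ψ : B →L[ℂ] ℂ} {e : B} (h : RenewalSetting Rn p C ψ e) :
    ∀ᶠ z in 𝓝 (0 : ℂ), HasSum (fun k => z ^ k • renewalOperator Rn k) (renewalResolvent Rn z) := by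
  have hC := h.const_pos
  have hR : ∀ j, ‖Rn (j + 1)‖ ≤ C := fun j => (h.norm_le j).trans
    (mul_le_of_le_one_right hC.le (by linarith [h.tail.nonneg (j + 1), h.tail.le_one j]))
  have hrad : 0 < (1 + C)⁻¹ := by positivity
  filter_upwards [Metric.ball_mem_nhds (0 : ℂ) hrad] with z hz
  have hz' : ‖z‖ < (1 + C)⁻¹ := by simpa using hz
  have hz1 : ‖z‖ < 1 := hz'.trans_le (inv_le_one_of_one_le₀ (by linarith))
  have hgeo : ‖z‖ * (1 + C) < 1 := by
    rwa [← lt_div_iff₀ (by positivity), one_div]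
  have hs1 : Summable fun k => ‖z ^ k • renewalOperator Rn k‖ := by
    refine Summable.of_nonneg_of_le (fun k => norm_nonneg _) (fun k => ?_)
      (summable_geometric_of_lt_one (by positivity) hgeo)
    rw [norm_smul, norm_pow, mul_pow]
    gcongr
    exact norm_renewalOperator_le hC.le hR k
  have hs2 : Summable fun k => ‖z ^ (k + 1) • Rn (k + 1)‖ :=
    Summable.of_nonneg_of_le (fun k => norm_nonneg _)
      (norm_returnSeries_term_le h.norm_le hz1.le) (h.tail.summable_diff.mul_left C)
  have hsum := hs1.of_norm.hasSum
  set S := ∑' k, z ^ k • renewalOperator Rn k with hS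
  have hprod : S * returnSeries Rn z = ∑' n, z ^ (n + 1) • renewalOperator Rn (n + 1) := by
    rw [hS, returnSeries, tsum_mul_tsum_eq_tsum_sum_range_of_summable_norm hs1 hs2]
    refine tsum_congr fun n => ?_
    rw [renewalOperator_succ, Finset.smul_sum, ← Finset.sum_range_reflect]
    refine Finset.sum_congr rfl fun j hj => ?_
    have hj' : j ≤ n := Nat.lt_succ_iff.1 (Finset.mem_range.1 hj)
    have e1 : n + 1 - 1 - j = n - j := by omega
    have e2 : n - (n - j) = j := by omega
    rw [e1, e2, smul_mul_smul_comm, ← pow_add]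
    congr 2
    omega
  have hS1 : S = 1 + S * returnSeries Rn z := by
    rw [hprod, hS, hs1.of_norm.tsum_eq_zero_add, pow_zero, one_smul, renewalOperator]
    rfl
  have hu := h.isUnit_one_sub z hz1.le (by rintro rfl; simp at hz1)
  have hinv : S * (1 - returnSeries Rn z) = 1 := by
    rw [mul_sub, mul_one, sub_eq_iff_eq_add]; exact hS1
  have : S = renewalResolvent Rn z := by
    calc S = S * (1 - returnSeries Rn z) * renewalResolvent Rn z := by
          rw [mul_assoc, renewalResolvent, Ring.mul_inverse_cancel _ hu, mul_one]
      _ = renewalResolvent Rn z := by rw [hinv, one_mul]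
  rwa [← this]

end GeneratingFunction

section CircleEstimates

theorem half_le_natCast_mul_norm_one_sub_exp (u : ℝ) {n : ℕ} (hn : 1 ≤ n) :
    1 / 2 ≤ n * ‖1 - Complex.exp (-(1 - u * Complex.I) / n)‖ := by
  have hn' : (1 : ℝ) ≤ n := by exact_mod_cast hn
  have hn0 : (0 : ℝ) < n := by linarith
  have h1 : ‖Complex.exp (-(1 - u * Complex.I) / n)‖ = Real.exp (-(1 / n)) := by
    rw [Complex.norm_exp, Complex.div_natCast_re]; congr 1; simp [neg_div]
  have h2 : 1 - Real.exp (-(1 / n)) ≤ ‖1 - Complex.exp (-(1 - u * Complex.I) / n)‖ := by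
    have := norm_sub_norm_le (1 : ℂ) (Complex.exp (-(1 - u * Complex.I) / n))
    rwa [h1, norm_one] at this
  have h3 : Real.exp (-(1 / n)) ≤ n / (n + 1) := by
    rw [Real.exp_neg, ← one_div, div_le_div_iff₀ (Real.exp_pos _) (by linarith)]
    have := Real.add_one_le_exp (1 / (n : ℝ))
    have h5 : (n : ℝ) * (1 / n + 1) = 1 + n := by field_simp
    nlinarith
  have h4 : 1 / 2 ≤ (n : ℝ) * (1 - n / (n + 1)) := by
    have : (n : ℝ) * (1 - n / (n + 1)) = n / (n + 1) := by field_simp; ring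
    rw [this, le_div_iff₀ (by linarith)]; linarith
  refine h4.trans ?_
  gcongr
  linarith

theorem one_add_abs_le_natCast_mul_norm_one_sub_exp {u : ℝ} {n : ℕ} (hn : 1 ≤ n)
    (hu : |u| ≤ n * Real.pi) :
    (1 + |u|) / 8 ≤ n * ‖1 - Complex.exp (-(1 - u * Complex.I) / n)‖ := by
  have hhalf := half_le_natCast_mul_norm_one_sub_exp u hn
  have hn0 : (0 : ℝ) < n := by exact_mod_cast hn
  have hnc : (n : ℂ) ≠ 0 := by exact_mod_cast hn0.ne'
  set z := Complex.exp (-(1 - u * Complex.I) / n) with hz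
  set w := Complex.exp (Complex.I * (u / n : ℝ)) with hw
  set r := Real.exp (-(1 / n)) with hr
  have hzw : z = r * w := by
    rw [hz, hw, hr, Complex.ofReal_exp, ← Complex.exp_add]
    congr 1; push_cast; field_simp; ring
  have hw1 : ‖w‖ = 1 := by rw [hw, mul_comm, Complex.norm_exp_ofReal_mul_I]
  have hr1 : r ≤ 1 := Real.exp_le_one_iff.2 (by rw [neg_nonpos]; positivity)
  have hr0 : 0 < r := Real.exp_pos _
  have h1 : 1 - r ≤ ‖1 - z‖ := by
    have := norm_sub_norm_le (1 : ℂ) z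
    rwa [hzw, norm_mul, hw1, mul_one, Complex.norm_of_nonneg hr0.le, norm_one, ← hzw] at this
  have h2 : ‖w - 1‖ ≤ 2 * ‖1 - z‖ := by
    have e1 : w - 1 = (1 - r : ℝ) * w - (1 - z) := by rw [hzw]; push_cast; ring
    have e2 : ‖((1 - r : ℝ) : ℂ) * w‖ = 1 - r := by
      rw [norm_mul, hw1, mul_one, Complex.norm_of_nonneg (by linarith)]
    rw [e1]
    refine (norm_sub_le _ _).trans ?_
    rw [e2]; linarith
  have h3 : 2 / Real.pi * |u / n / 2| ≤ |Real.sin (u / n / 2)| := by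
    refine Real.mul_abs_le_abs_sin ?_
    rw [abs_div, abs_div, abs_of_pos hn0, abs_two]
    have : |u| / n ≤ Real.pi := by rw [div_le_iff₀ hn0]; linarith
    linarith
  have h4 : |u| / n / Real.pi ≤ ‖1 - z‖ := by
    rw [hw, Complex.norm_exp_I_mul_ofReal_sub_one, norm_mul, Real.norm_ofNat,
      Real.norm_eq_abs] at h2
    have e3 : 2 / Real.pi * |u / n / 2| = |u| / n / Real.pi := by
      rw [abs_div, abs_div, abs_of_pos hn0, abs_two]; field_simp
    linarith
  have h5 : |u| / 4 ≤ n * ‖1 - z‖ := by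
    calc |u| / 4 ≤ |u| / Real.pi := by
          gcongr; exact Real.pi_le_four
      _ = n * (|u| / n / Real.pi) := by field_simp
      _ ≤ _ := by gcongr
  linarith [abs_nonneg u]

theorem norm_exp_sub_exp_add_pi_le (u : ℝ) {n : ℕ} (hn : 1 ≤ n) :
    ‖Complex.exp (-(1 - u * Complex.I) / n) -
      Complex.exp (-(1 - (u + Real.pi : ℝ) * Complex.I) / n)‖ ≤ Real.pi / n := by
  have hn0 : (0 : ℝ) < n := by exact_mod_cast hn
  have hnc : (n : ℂ) ≠ 0 := by exact_mod_cast hn0.ne'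
  have h1 : Complex.exp (-(1 - (u + Real.pi : ℝ) * Complex.I) / n) =
      Complex.exp (-(1 - u * Complex.I) / n) * Complex.exp (Complex.I * (Real.pi / n : ℝ)) := by
    rw [← Complex.exp_add]; congr 1; push_cast; field_simp; ring
  have h2 : ‖Complex.exp (-(1 - u * Complex.I) / n)‖ ≤ 1 :=
    (norm_exp_neg_div_lt_one (by simp) hn).le
  have h3 := Real.norm_exp_I_mul_ofReal_sub_one_le (x := Real.pi / n)
  rw [Real.norm_of_nonneg (by positivity)] at h3
  rw [h1, norm_sub_rev, ← mul_sub_one, norm_mul]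
  calc _ ≤ 1 * (Real.pi / n) := by gcongr
    _ = _ := one_mul _

end CircleEstimates

namespace RenewalSetting

variable {B : Type*} [NormedAddCommGroup B] [NormedSpace ℂ B] [CompleteSpace B]
  {Rn : ℕ → B →L[ℂ] B} {p : ℕ → ℝ} {C : ℝ} {ψ : B →L[ℂ] ℂ} {e : B}
  (h : RenewalSetting Rn p C ψ e)
include h

theorem norm_renewalResolvent_sub_le {z w : ℂ} (hz : ‖z‖ < 1) (hw : ‖w‖ < 1) {n : ℕ} (hn : 1 ≤ n) :
    ‖renewalResolvent Rn z - renewalResolvent Rn w‖ ≤ ‖renewalResolvent Rn z‖ *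
      (C * (‖z - w‖ + 2 / n) * truncMean p n) * ‖renewalResolvent Rn w‖ := by
  have hz1 := Ring.inverse_mul_cancel _
    (h.isUnit_one_sub z hz.le (by rintro rfl; simp at hz))
  have hw1 := Ring.mul_inverse_cancel _
    (h.isUnit_one_sub w hw.le (by rintro rfl; simp at hw))
  have heq : renewalResolvent Rn z - renewalResolvent Rn w =
      renewalResolvent Rn z * (returnSeries Rn z - returnSeries Rn w) *
        renewalResolvent Rn w := by
    have e1 : returnSeries Rn z - returnSeries Rn w =
        (1 - returnSeries Rn w) - (1 - returnSeries Rn z) := by abel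
    have hz2 : renewalResolvent Rn z * (1 - returnSeries Rn z) = 1 := hz1
    have hw2 : (1 - returnSeries Rn w) * renewalResolvent Rn w = 1 := hw1
    rw [e1, mul_sub, sub_mul, hz2, mul_assoc, hw2, mul_one, one_mul]
  rw [heq]
  refine (norm_mul_le _ _).trans ?_
  gcongr
  refine (norm_mul_le _ _).trans ?_
  gcongr
  exact norm_returnSeries_sub_le h.tail h.const_pos h.norm_le hz.le hw.le hn

/-- The generating function of `M n • T_k - P`, where `M n` is the truncated mean. -/
theorem eventually_hasSum_sub (n : ℕ) :
    ∀ᶠ z in 𝓝 (0 : ℂ), HasSum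
      (fun k => z ^ k • ((truncMean p n : ℂ) • renewalOperator Rn k - ψ.smulRight e))
      ((truncMean p n : ℂ) • renewalResolvent Rn z - (1 - z)⁻¹ • ψ.smulRight e) := by
  filter_upwards [h.eventually_hasSum_renewalOperator,
    Metric.ball_mem_nhds (0 : ℂ) one_pos] with z h1 hz
  have h2 : HasSum (fun k => z ^ k • ψ.smulRight e) ((1 - z)⁻¹ • ψ.smulRight e) :=
    (hasSum_geometric_of_norm_lt_one (by simpa using hz)).smul_const _
  refine ((h1.const_smul (truncMean p n : ℂ)).sub h2).congr_fun ?_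
  intro k
  rw [smul_sub, smul_comm]

theorem differentiableOn_sub (n : ℕ) :
    DifferentiableOn ℂ (fun z => (truncMean p n : ℂ) • renewalResolvent Rn z -
      (1 - z)⁻¹ • ψ.smulRight e) (Metric.ball 0 1) := by
  have hR := differentiableOn_returnSeries h.tail h.norm_le
  have hne : ∀ z ∈ Metric.ball (0 : ℂ) 1, ‖z‖ ≤ 1 ∧ z ≠ 1 := by
    intro z hz
    have hz' : ‖z‖ < 1 := by simpa using hz
    exact ⟨hz'.le, by rintro rfl; simp at hz'⟩
  have hT : DifferentiableOn ℂ (renewalResolvent Rn) (Metric.ball 0 1) := fun z hz =>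
    (differentiableAt_inverse (h.isUnit_one_sub z (hne z hz).1 (hne z hz).2)).comp_differentiableWithinAt
      (f := fun w => 1 - returnSeries Rn w) z ((hR z hz).const_sub 1)
  refine (hT.const_smul (truncMean p n : ℂ)).sub (DifferentiableOn.smul_const ?_ _)
  exact (differentiableOn_id.const_sub 1).inv fun z hz => sub_ne_zero.2 (hne z hz).2.symm

/-- Uniform bound for the oscillation at scale `π / n` on the circle of radius `exp (-1 / n)`. -/
theorem exists_oscillation_le : ∃ K : ℝ, ∀ (n : ℕ) (u : ℝ), 1 ≤ n → |u| ≤ n * Real.pi →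
    (n : ℝ)⁻¹ *
      ‖((truncMean p n : ℂ) • renewalResolvent Rn (Complex.exp (-(1 - u * Complex.I) / n)) -
          (1 - Complex.exp (-(1 - u * Complex.I) / n))⁻¹ • ψ.smulRight e) -
        ((truncMean p n : ℂ) • renewalResolvent Rn
            (Complex.exp (-(1 - (u + Real.pi : ℝ) * Complex.I) / n)) -
          (1 - Complex.exp (-(1 - (u + Real.pi : ℝ) * Complex.I) / n))⁻¹ • ψ.smulRight e)‖ ≤
      K * (1 + ‖u‖) ^ (-(3 / 2) : ℝ) := by
  obtain ⟨K, hK, hbound⟩ := h.exists_norm_renewalResolvent_pow_le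
  set K₁ : ℝ := K ^ 2 * 8 ^ 9 + 1 with hK₁
  refine ⟨6 * C * K₁ + 8 ^ 3 * Real.pi * ‖ψ.smulRight e‖, fun n u hn hu => ?_⟩
  have hn0 : (0 : ℝ) < n := by exact_mod_cast hn
  have hC := h.const_pos
  have hM := h.tail.truncMean_pos hn
  have hpi4 := Real.pi_lt_four
  have hz : ‖Complex.exp (-(1 - u * Complex.I) / n)‖ < 1 :=
    norm_exp_neg_div_lt_one (by simp) hn
  have hw : ‖Complex.exp (-(1 - (u + Real.pi : ℝ) * Complex.I) / n)‖ < 1 :=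
    norm_exp_neg_div_lt_one (by simp) hn
  have hX := one_add_abs_le_natCast_mul_norm_one_sub_exp hn hu
  have hX2 := half_le_natCast_mul_norm_one_sub_exp u hn
  have hW2 := half_le_natCast_mul_norm_one_sub_exp (u + Real.pi) hn
  have hzw := norm_exp_sub_exp_add_pi_le u hn
  set z := Complex.exp (-(1 - u * Complex.I) / n) with hzd
  set w := Complex.exp (-(1 - (u + Real.pi : ℝ) * Complex.I) / n) with hwd
  set X := (n : ℝ) * ‖1 - z‖ with hXd
  set W := (n : ℝ) * ‖1 - w‖ with hWd
  have hTz := hbound z n hz hn hX2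
  have hTw := hbound w n hw hn hW2
  rw [← hXd] at hTz
  rw [← hWd] at hTw
  have hXW : X ≤ 8 * W := by
    have h1 : ‖1 - z‖ ≤ ‖1 - w‖ + Real.pi / n := by
      have e1 : 1 - z = (1 - w) - (z - w) := by ring
      rw [e1]
      exact (norm_sub_le _ _).trans (by linarith)
    have h2 : X ≤ W + Real.pi := by
      calc X ≤ n * (‖1 - w‖ + Real.pi / n) := by rw [hXd]; gcongr
        _ = W + Real.pi := by rw [hWd]; field_simp
    have := Real.pi_lt_d2
    nlinarith
  have hX0 : 0 < X := by linarith
  have hW0 : 0 < W := by linarith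
  have hqz : 0 < ‖1 - z‖ := pos_of_mul_pos_right hX0 hn0.le
  have hqw : 0 < ‖1 - w‖ := pos_of_mul_pos_right hW0 hn0.le
  set Y := 1 + ‖u‖ with hY
  have hY1 : 1 ≤ Y := by linarith [norm_nonneg u]
  have hYX : Y ≤ 8 * X := by rw [hY, Real.norm_eq_abs]; linarith
  set s := Y ^ (-(3 / 2) : ℝ) with hs
  have hs0 : 0 < s := Real.rpow_pos_of_pos (by linarith) _
  have hs4 : s ^ 4 * Y ^ 6 = 1 := by
    rw [hs, ← Real.rpow_natCast, ← Real.rpow_mul (by linarith), ← Real.rpow_natCast Y 6,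
      ← Real.rpow_add (by linarith)]
    norm_num
  have hs2 : 1 ≤ s * Y ^ 2 := by
    rw [hs, ← Real.rpow_natCast Y 2, ← Real.rpow_add (by linarith)]
    exact Real.one_le_rpow hY1 (by norm_num)
  set a := ‖renewalResolvent Rn z‖ * truncMean p n / n with ha
  set b := ‖renewalResolvent Rn w‖ * truncMean p n / n with hb
  have ha0 : 0 ≤ a := by positivity
  have hb0 : 0 ≤ b := by positivity
  have haX : a ^ 4 * X ^ 3 ≤ K := by
    rw [ha, div_pow, mul_pow, div_mul_eq_mul_div, div_le_iff₀ (by positivity)]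
    exact hTz
  have hbW : b ^ 4 * W ^ 3 ≤ K := by
    rw [hb, div_pow, mul_pow, div_mul_eq_mul_div, div_le_iff₀ (by positivity)]
    exact hTw
  have hab : a * b ≤ K₁ * s := by
    have hK1 : 1 ≤ K₁ := by rw [hK₁]; linarith [show 0 ≤ K ^ 2 * 8 ^ 9 by positivity]
    refine le_of_pow_le_pow_left₀ (n := 4) (by norm_num) (by positivity) ?_
    refine le_of_mul_le_mul_right (a := Y ^ 6) ?_ (by positivity)
    calc (a * b) ^ 4 * Y ^ 6 = a ^ 4 * b ^ 4 * (Y ^ 3 * Y ^ 3) := by ring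
      _ ≤ a ^ 4 * b ^ 4 * ((8 * X) ^ 3 * (8 * (8 * W)) ^ 3) := by
        have : Y ≤ 8 * (8 * W) := by linarith
        gcongr
      _ = (a ^ 4 * X ^ 3) * (b ^ 4 * W ^ 3) * 8 ^ 9 := by ring
      _ ≤ K * K * 8 ^ 9 := by gcongr
      _ ≤ K₁ := by rw [hK₁]; linarith
      _ ≤ K₁ ^ 4 := le_self_pow₀ hK1 (by norm_num)
      _ = (K₁ * s) ^ 4 * Y ^ 6 := by rw [mul_pow, mul_assoc, hs4, mul_one]
  have hpart : (n : ℝ)⁻¹ * (truncMean p n * ‖renewalResolvent Rn z - renewalResolvent Rn w‖) ≤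
      6 * C * K₁ * s := by
    have h1 := h.norm_renewalResolvent_sub_le hz hw hn
    have h2 : ‖z - w‖ + 2 / n ≤ 6 / n := by
      calc ‖z - w‖ + 2 / n ≤ Real.pi / n + 2 / n := by linarith
        _ = (Real.pi + 2) / n := by ring
        _ ≤ 6 / n := by gcongr; linarith
    calc (n : ℝ)⁻¹ * (truncMean p n * ‖renewalResolvent Rn z - renewalResolvent Rn w‖)
        ≤ (n : ℝ)⁻¹ * (truncMean p n * (‖renewalResolvent Rn z‖ *
          (C * (6 / n) * truncMean p n) * ‖renewalResolvent Rn w‖)) := by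
          gcongr
          refine h1.trans ?_
          gcongr
      _ = 6 * C * (a * b) := by rw [ha, hb]; field_simp
      _ ≤ 6 * C * (K₁ * s) := by gcongr
      _ = _ := by ring
  have hpole : (n : ℝ)⁻¹ * ‖(1 - z)⁻¹ - (1 - w)⁻¹‖ ≤ 8 ^ 3 * Real.pi * s := by
    have h1 : (1 - z)⁻¹ - (1 - w)⁻¹ = (z - w) / ((1 - z) * (1 - w)) := by
      have e1 : 1 - z ≠ 0 := norm_pos_iff.1 hqz
      have e2 : 1 - w ≠ 0 := norm_pos_iff.1 hqw
      field_simp; ring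
    rw [h1, norm_div, norm_mul]
    calc (n : ℝ)⁻¹ * (‖z - w‖ / (‖1 - z‖ * ‖1 - w‖))
        ≤ (n : ℝ)⁻¹ * ((Real.pi / n) / (‖1 - z‖ * ‖1 - w‖)) := by gcongr
      _ = Real.pi / (X * W) := by rw [hXd, hWd]; field_simp
      _ ≤ Real.pi * (8 ^ 3 * s) := by
        rw [div_eq_mul_one_div]
        gcongr
        rw [div_le_iff₀ (by positivity)]
        calc 1 ≤ s * Y ^ 2 := hs2
          _ = s * (Y * Y) := by ring
          _ ≤ s * ((8 * X) * (8 * (8 * W))) := by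
            have : Y ≤ 8 * (8 * W) := by linarith
            gcongr
          _ = _ := by ring
      _ = _ := by ring
  set P := ψ.smulRight e with hP
  have hsplit : ((truncMean p n : ℂ) • renewalResolvent Rn z - (1 - z)⁻¹ • P) -
      ((truncMean p n : ℂ) • renewalResolvent Rn w - (1 - w)⁻¹ • P) =
      (truncMean p n : ℂ) • (renewalResolvent Rn z - renewalResolvent Rn w) -
        ((1 - z)⁻¹ - (1 - w)⁻¹) • P := by
    rw [smul_sub, sub_smul]; abel
  rw [hsplit]
  calc _ ≤ (n : ℝ)⁻¹ * (truncMean p n * ‖renewalResolvent Rn z - renewalResolvent Rn w‖ +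
        ‖(1 - z)⁻¹ - (1 - w)⁻¹‖ * ‖P‖) := by
        gcongr
        refine (norm_sub_le _ _).trans ?_
        rw [norm_smul, norm_smul, Complex.norm_of_nonneg hM.le]
    _ = (n : ℝ)⁻¹ * (truncMean p n * ‖renewalResolvent Rn z - renewalResolvent Rn w‖) +
        (n : ℝ)⁻¹ * ‖(1 - z)⁻¹ - (1 - w)⁻¹‖ * ‖P‖ := by ring
    _ ≤ 6 * C * K₁ * s + 8 ^ 3 * Real.pi * s * ‖P‖ := by gcongr
    _ = _ := by ring

theorem tendsto_inv_smul_sub (u : ℝ) :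
    Tendsto (fun n : ℕ => (n : ℝ)⁻¹ *
      ‖(truncMean p n : ℂ) • renewalResolvent Rn (Complex.exp (-(1 - u * Complex.I) / n)) -
          (1 - Complex.exp (-(1 - u * Complex.I) / n))⁻¹ • ψ.smulRight e‖) atTop (𝓝 0) := by
  have hre : 0 < (1 - u * Complex.I).re := by simp
  have hc : (1 - u * Complex.I) ≠ 0 := by intro h0; rw [h0] at hre; simp at hre
  have h1 := h.tendsto_renewalResolvent_exp hre
  have h2 := ((tendsto_natCast_mul_one_sub_exp (1 - u * Complex.I)).inv₀ hc).smul_const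
    (ψ.smulRight e)
  have h3 := (h1.sub h2).norm
  rw [sub_self, norm_zero] at h3
  refine h3.congr fun n => ?_
  have e1 : (n : ℝ)⁻¹ = ‖(n : ℂ)⁻¹‖ := by simp
  rw [e1, ← norm_smul, smul_sub, smul_smul, smul_smul, mul_inv]
  congr 4
  push_cast
  ring

/-- The strong renewal theorem for operators: `M n • T_n → P`, with `M n` the truncated mean. -/
theorem tendsto_truncMean_smul_renewalOperator :
    Tendsto (fun n : ℕ => (truncMean p n : ℂ) • renewalOperator Rn n) atTop
      (𝓝 (ψ.smulRight e)) := by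
  obtain ⟨K, hK⟩ := h.exists_oscillation_le
  set D : ℕ → ℂ → B →L[ℂ] B := fun n z =>
    (truncMean p n : ℂ) • renewalResolvent Rn z - (1 - z)⁻¹ • ψ.smulRight e with hD
  set G : ℕ → ℝ → ℝ := fun n u => (n : ℝ)⁻¹ *
    ‖D n (Complex.exp (-(1 - u * Complex.I) / n)) -
      D n (Complex.exp (-(1 - (u + Real.pi : ℝ) * Complex.I) / n))‖ with hG
  have hcont : ∀ n, 1 ≤ n → Continuous (G n) := by
    intro n hn
    have hc : Continuous fun u : ℝ => D n (Complex.exp (-(1 - u * Complex.I) / n)) :=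
      (h.differentiableOn_sub n).continuousOn.comp_continuous (by fun_prop) fun u => by
        simpa using norm_exp_neg_div_lt_one (c := 1 - u * Complex.I) (by simp) hn
    exact continuous_const.mul (hc.sub (hc.comp (continuous_add_const Real.pi))).norm
  have hpt : ∀ u, Tendsto (fun n => G n u) atTop (𝓝 0) := by
    intro u
    have h1 := (h.tendsto_inv_smul_sub u).add (h.tendsto_inv_smul_sub (u + Real.pi))
    rw [add_zero] at h1
    refine squeeze_zero (fun n => by positivity) (fun n => ?_) h1
    rw [← mul_add]
    exact mul_le_mul_of_nonneg_left (norm_sub_le _ _) (by positivity)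
  have hint : Tendsto (fun n : ℕ => ∫ u, (Set.Ioc (-(n * Real.pi)) (n * Real.pi)).indicator (G n) u)
      atTop (𝓝 (∫ _ : ℝ, (0 : ℝ))) := by
    refine tendsto_integral_filter_of_dominated_convergence
      (fun u : ℝ => |K| * (1 + ‖u‖) ^ (-(3 / 2) : ℝ)) ?_ ?_ ?_ ?_
    · filter_upwards [eventually_ge_atTop 1] with n hn
      exact ((hcont n hn).aestronglyMeasurable).indicator measurableSet_Ioc
    · filter_upwards [eventually_ge_atTop 1] with n hn
      refine Eventually.of_forall fun u => ?_
      by_cases hu : u ∈ Set.Ioc (-(n * Real.pi)) (n * Real.pi)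
      · rw [Set.indicator_of_mem hu, Real.norm_of_nonneg (by positivity)]
        refine (hK n u hn (abs_le.2 ⟨hu.1.le, hu.2⟩)).trans ?_
        gcongr
        exact le_abs_self K
      · rw [Set.indicator_of_notMem hu, norm_zero]
        positivity
    · refine (integrable_one_add_norm ?_).const_mul _
      norm_num
    · refine Eventually.of_forall fun u => ?_
      refine squeeze_zero (fun n => Set.indicator_nonneg (fun _ _ => by positivity) _)
        (fun n => ?_) (hpt u)
      exact Set.indicator_le_self' (fun _ _ => by positivity) _
  rw [integral_zero] at hint
  rw [tendsto_iff_norm_sub_tendsto_zero]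
  refine squeeze_zero' (Eventually.of_forall fun n => norm_nonneg _) ?_ hint
  filter_upwards [eventually_ge_atTop 1] with n hn
  have h1 := norm_taylorCoeff_le_integral (h.differentiableOn_sub n)
    (h.eventually_hasSum_sub n) hn
  refine h1.trans_eq ?_
  have hpi := Real.pi_pos
  have hn0 : (0 : ℝ) ≤ n := Nat.cast_nonneg n
  rw [intervalIntegral.integral_of_le (by nlinarith), integral_indicator measurableSet_Ioc]

end RenewalSetting

section TransferFacts

variable {Y : Type*} [MeasurableSpace Y] {μ : Measure Y} [IsProbabilityMeasure μ] {F : Y → Y}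

theorem integrable_linfty (v : Lp ℂ ∞ μ) : Integrable v μ := (Lp.memLp v).integrable le_top

omit [IsProbabilityMeasure μ] in
theorem norm_linfty_le (v : Lp ℂ ∞ μ) : ∀ᵐ y ∂μ, ‖v y‖ ≤ ‖v‖ := by
  filter_upwards [ae_le_eLpNormEssSup (f := v) (μ := μ)] with y hy
  rw [Lp.norm_def, eLpNorm_exponent_top, ← toReal_enorm]
  refine ENNReal.toReal_mono ?_ hy
  rw [← eLpNorm_exponent_top]
  exact Lp.eLpNorm_ne_top v

/-- Integration over a set as a continuous linear functional on `L^∞(μ)`. -/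
noncomputable def setIntegralLinfty (μ : Measure Y) [IsProbabilityMeasure μ] (s : Set Y) :
    Lp ℂ ∞ μ →L[ℂ] ℂ :=
  LinearMap.mkContinuous
    { toFun := fun v => ∫ y in s, v y ∂μ
      map_add' := fun v v' => by
        rw [← integral_add (integrable_linfty v).integrableOn (integrable_linfty v').integrableOn]
        exact integral_congr_ae (ae_restrict_of_ae (Lp.coeFn_add v v'))
      map_smul' := fun c v => by
        rw [RingHom.id_apply, smul_eq_mul, ← integral_const_mul]
        exact integral_congr_ae (ae_restrict_of_ae (Lp.coeFn_smul c v)) }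
    1 fun v => by
      have h1 := norm_integral_le_of_norm_le_const (ae_restrict_of_ae (s := s) (norm_linfty_le v))
      refine h1.trans ?_
      rw [mul_comm]
      gcongr
      rw [measureReal_restrict_apply_univ]
      exact measureReal_le_one

theorem setIntegralLinfty_apply (s : Set Y) (v : Lp ℂ ∞ μ) :
    setIntegralLinfty μ s v = ∫ y in s, v y ∂μ := rfl

theorem setIntegralLinfty_univ : setIntegralLinfty μ Set.univ = integralLinfty μ := by
  ext v
  rw [setIntegralLinfty_apply, setIntegral_univ]
  rfl

theorem setIntegralLinfty_const (s : Set Y) :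
    setIntegralLinfty μ s (Lp.const ∞ μ (1 : ℂ)) = (μ.real s : ℂ) := by
  rw [setIntegralLinfty_apply,
    integral_congr_ae (ae_restrict_of_ae (Lp.coeFn_const (p := ∞) (μ := μ) (1 : ℂ)))]
  simp

theorem linftyToL1_coeFn (v : Lp ℂ ∞ μ) : (linftyToL1 v : Y → ℂ) =ᵐ[μ] v :=
  MemLp.coeFn_toLp _

omit [MeasurableSpace Y] in
theorem mul_indicator_one (f : Y → ℂ) (s : Set Y) :
    (fun y => f y * s.indicator (fun _ => (1 : ℂ)) y) = s.indicator f := by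
  ext y
  by_cases hy : y ∈ s <;> simp [hy]

theorem setIntegral_transferOperator (hF : MeasurePreserving F μ μ) (v : Lp ℂ 1 μ) {s : Set Y}
    (hs : MeasurableSet s) :
    ∫ y in s, transferOperator hF v y ∂μ = ∫ y in F ⁻¹' s, v y ∂μ := by
  have h1 := transferOperator_spec hF v (s.indicator fun _ => (1 : ℂ))
    ((memLp_const (1 : ℂ)).indicator hs)
  rw [mul_indicator_one, integral_indicator hs] at h1
  rw [h1, ← integral_indicator (hF.measurable hs), ← mul_indicator_one v]
  rfl

omit [IsProbabilityMeasure μ] in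
theorem setIntegral_toLp_indicator (v : Lp ℂ 1 μ) {t : Set Y} (ht : MeasurableSet t)
    (hv : MemLp (t.indicator v) 1 μ) (s : Set Y) :
    ∫ y in s, hv.toLp (t.indicator v) y ∂μ = ∫ y in s ∩ t, v y ∂μ := by
  rw [integral_congr_ae (ae_restrict_of_ae hv.coeFn_toLp), setIntegral_indicator ht]

theorem setIntegral_eq_of_returnOperator (hF : MeasurePreserving F μ μ) {φ : Y → ℕ}
    (hφ : Measurable φ) {n : ℕ} {v v' : Lp ℂ ∞ μ}
    (hv : linftyToL1 v' = returnOperator hF hφ n (linftyToL1 v)) {s : Set Y}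
    (hs : MeasurableSet s) :
    ∫ y in s, v' y ∂μ = ∫ y in φ ⁻¹' {n} ∩ F ⁻¹' s, v y ∂μ := by
  rw [← integral_congr_ae (ae_restrict_of_ae (linftyToL1_coeFn v')), hv, returnOperator,
    setIntegral_transferOperator hF _ hs, Set.inter_comm,
    setIntegral_toLp_indicator _ (hφ (measurableSet_singleton n))]
  exact integral_congr_ae (ae_restrict_of_ae (linftyToL1_coeFn v))

variable {φ : Y → ℕ}

theorem measureReal_eq_sub (hφ : Measurable φ) (j : ℕ) :
    μ.real {y | φ y = j + 1} = μ.real {y | j < φ y} - μ.real {y | j + 1 < φ y} := by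
  have hm : MeasurableSet {y | j + 1 < φ y} := measurableSet_lt measurable_const hφ
  have hsub : {y | j + 1 < φ y} ⊆ {y | j < φ y} := fun y hy =>
    lt_trans (Nat.lt_succ_self j) hy
  rw [← measureReal_sdiff hsub hm]
  congr 1
  ext y
  simp only [Set.mem_ofPred_eq, Set.mem_sdiff]
  omega

variable {B : Type*} [NormedAddCommGroup B] [NormedSpace ℂ B]
  {ι : B →L[ℂ] Lp ℂ ∞ μ} {Rn : ℕ → B →L[ℂ] B}

theorem setIntegral_returnSeries_one (hF : MeasurePreserving F μ μ) (hφ : Measurable φ)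
    (hφpos : ∀ y, 1 ≤ φ y)
    (hRn : ∀ n : ℕ, 1 ≤ n → ∀ v : B,
      linftyToL1 (ι (Rn n v)) = returnOperator hF hφ n (linftyToL1 (ι v)))
    (hsum : HasSum (fun n => (1 : ℂ) ^ (n + 1) • Rn (n + 1)) (returnSeries Rn 1))
    {s : Set Y} (hs : MeasurableSet s) (v : B) :
    ∫ y in s, ι (returnSeries Rn 1 v) y ∂μ = ∫ y in F ⁻¹' s, ι v y ∂μ := by
  have h1 := ((setIntegralLinfty μ s).comp
    (ι.comp (ContinuousLinearMap.apply ℂ B v))).hasSum hsum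
  simp only [ContinuousLinearMap.comp_apply, ContinuousLinearMap.apply_apply, one_pow,
    one_smul, setIntegralLinfty_apply] at h1
  simp only [setIntegral_eq_of_returnOperator hF hφ (hRn _ (Nat.le_add_left 1 _) v) hs] at h1
  have hunion : ⋃ n : ℕ, φ ⁻¹' {n + 1} ∩ F ⁻¹' s = F ⁻¹' s := by
    ext y
    simp only [Set.mem_iUnion, Set.mem_inter_iff, Set.mem_preimage, Set.mem_singleton_iff]
    constructor
    · rintro ⟨_, _, h⟩; exact h
    · intro h
      exact ⟨φ y - 1, by have := hφpos y; omega, h⟩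
  have h2 := hasSum_integral_iUnion (μ := μ) (f := ι v)
    (s := fun n : ℕ => φ ⁻¹' {n + 1} ∩ F ⁻¹' s)
    (fun n => (hφ (measurableSet_singleton _)).inter (hF.measurable hs))
    (fun i j hij => Set.disjoint_left.2 fun y hy hy' => hij (by
      have e1 : φ y = i + 1 := hy.1
      have e2 : φ y = j + 1 := hy'.1
      omega))
    (integrable_linfty (ι v)).integrableOn
  rw [hunion] at h2
  exact h1.unique h2

theorem returnSeries_one_apply_one (hF : MeasurePreserving F μ μ) (hφ : Measurable φ)
    (hφpos : ∀ y, 1 ≤ φ y) (hι : Function.Injective ι) {one : B}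
    (hone : ι one = Lp.const ∞ μ (1 : ℂ))
    (hRn : ∀ n : ℕ, 1 ≤ n → ∀ v : B,
      linftyToL1 (ι (Rn n v)) = returnOperator hF hφ n (linftyToL1 (ι v)))
    (hsum : HasSum (fun n => (1 : ℂ) ^ (n + 1) • Rn (n + 1)) (returnSeries Rn 1)) :
    returnSeries Rn 1 one = one := by
  refine hι (Lp.ext ((integrable_linfty _).ae_eq_of_forall_setIntegral_eq _ _
    (integrable_linfty _) fun s hs _ => ?_))
  rw [setIntegral_returnSeries_one hF hφ hφpos hRn hsum hs, ← setIntegralLinfty_apply,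
    ← setIntegralLinfty_apply, hone, setIntegralLinfty_const, setIntegralLinfty_const,
    measureReal_def, measureReal_def, hF.measure_preimage hs.nullMeasurableSet]

end TransferFacts

theorem operator_renewal_convergence_beta_one
    {Y : Type*} [MeasurableSpace Y] (μ : Measure Y) [IsProbabilityMeasure μ]
    (F : Y → Y) (hF : MeasurePreserving F μ μ)
    (φ : Y → ℕ) (hφ : Measurable φ) (hφpos : ∀ y, 1 ≤ φ y)
    -- regularly varying tails with `β = 1` and `∑ ℓ(j)/j = ∞`
    (l : ℝ → ℝ) (hl : SlowlyVarying l)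
    (htail : ∀ n : ℕ, 1 ≤ n → μ.real {y | n < φ y} = l n / n)
    (hdiv : Tendsto (fun n : ℕ => ∑ j ∈ Finset.Icc 1 n, l j / j) atTop atTop)
    -- the Banach space `B ⊆ L^∞(Y, μ)`, with its inclusion `ι`, containing the constants
    {B : Type*} [NormedAddCommGroup B] [NormedSpace ℂ B] [CompleteSpace B]
    (ι : B →L[ℂ] Lp ℂ ∞ μ) (hι : Function.Injective ι) (hι_norm : ∀ v : B, ‖ι v‖ ≤ ‖v‖)
    (one : B) (hone : ι one = Lp.const ∞ μ (1 : ℂ))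
    -- (H1): the operators `R_n` restrict to bounded operators on `B`
    (Rn : ℕ → B →L[ℂ] B)
    (hRn : ∀ n : ℕ, 1 ≤ n → ∀ v : B,
      linftyToL1 (ι (Rn n v)) = returnOperator hF hφ n (linftyToL1 (ι v)))
    (hH1 : ∃ C : ℝ, 0 < C ∧ ∀ n : ℕ, 1 ≤ n → ‖Rn n‖ ≤ C * μ.real {y | φ y = n})
    -- (H2)
    (hH2i : IsSimpleIsolatedEigenvalue (returnSeries Rn 1) 1)
    (hH2ii : ∀ z : ℂ, ‖z‖ ≤ 1 → z ≠ 1 → (1 : ℂ) ∉ spectrum ℂ (returnSeries Rn z)) :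
    -- `ℓ̃(n) T_n → P` in operator norm, where `P v = (∫ v dμ) · 1`
    Tendsto
      (fun n : ℕ => ((∑ j ∈ Finset.Icc 1 n, l j / j : ℝ) : ℂ) • renewalOperator Rn n)
      atTop (𝓝 (((integralLinfty μ).comp ι).smulRight one)) := by
  obtain ⟨C, hC, hCn⟩ := hH1
  set p : ℕ → ℝ := fun n => μ.real {y | n < φ y} with hpdef
  have hp : RelativelyStableTail p := by
    refine hl.relativelyStableTail (fun m n hmn => ?_) (fun n => measureReal_nonneg) ?_ htail hdiv
    · exact measureReal_mono fun y (hy : n < φ y) => lt_of_le_of_lt hmn hy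
    · have : {y | 0 < φ y} = Set.univ := Set.eq_univ_of_forall fun y => hφpos y
      simp [hpdef, this]
  have hR : ∀ j, ‖Rn (j + 1)‖ ≤ C * (p j - p (j + 1)) := fun j => by
    have := hCn (j + 1) (by omega)
    rwa [measureReal_eq_sub hφ j] at this
  have hsum := hasSum_returnSeries hp hR (z := 1) (by simp)
  set ψ : B →L[ℂ] ℂ := (integralLinfty μ).comp ι with hψ
  have hψapp : ∀ v, ψ v = ∫ y in Set.univ, ι v y ∂μ := fun v => by
    rw [hψ, ← setIntegralLinfty_univ]; rfl
  have he := returnSeries_one_apply_one hF hφ hφpos hι hone hRn hsum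
  have hψR : ψ.comp (returnSeries Rn 1) = ψ := by
    ext v
    rw [ContinuousLinearMap.comp_apply, hψapp, hψapp,
      setIntegral_returnSeries_one hF hφ hφpos hRn hsum MeasurableSet.univ, Set.preimage_univ]
  have hpair : ψ one = 1 := by
    rw [hψapp, ← setIntegralLinfty_apply, hone, setIntegralLinfty_const]
    simp
  have hset : RenewalSetting Rn p C ψ one :=
    { tail := hp
      const_pos := hC
      norm_le := hR
      map_eigenvector := he
      comp_eigenfunctional := hψR
      pairing := hpair
      pairing_return := fun j => by
        rw [hψapp, setIntegral_eq_of_returnOperator hF hφ (hRn (j + 1) (by omega) one)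
          MeasurableSet.univ, ← setIntegralLinfty_apply, hone, setIntegralLinfty_const,
          Set.preimage_univ, Set.inter_univ]
        exact congrArg _ (measureReal_eq_sub hφ j)
      isUnit_regularized := hH2i.isUnit_one_sub_add he hψR hpair
      isUnit_one_sub := fun z hz hz1 => by
        simpa using spectrum.notMem_iff.1 (hH2ii z hz hz1) }
  have hlim := ((Complex.continuous_ofReal.tendsto 1).comp
    hp.tendsto_sum_Icc_div_truncMean).smul hset.tendsto_truncMean_smul_renewalOperator
  rw [Complex.ofReal_one, one_smul] at hlim
  refine hlim.congr' ?_
  filter_upwards [eventually_ge_atTop 1] with n hn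
  have hM : (truncMean p n : ℂ) ≠ 0 := by exact_mod_cast (hp.truncMean_pos hn).ne'
  have hs : ∑ j ∈ Finset.Icc 1 n, l j / j = ∑ j ∈ Finset.Icc 1 n, p j :=
    Finset.sum_congr rfl fun j hj => (htail j (Finset.mem_Icc.1 hj).1).symm
  simp only [Function.comp_apply]
  rw [smul_smul, hs, Complex.ofReal_div, div_mul_cancel₀ _ hM]
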